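/- arXiv:1310.8186 — 2 statements merged into one kernel-verified Lean document; each statement's English description precedes it below -/
import Mathlib

section
/- Let G be a claw-free, K_4-free, 2-connected graph of maximum degree at most 4, and let (G1,G2) be a separation of G with V(G1 ∩ G2) = {u,v}. If G1 contains two induced u–v-paths of distinct parities, then G1 contains a u–v-linked obstruction. -/
open SimpleGraph

attribute [local instance] Classical.propDecidable

universe u

variable {V : Type u}

/-- A graph is subcubic if every vertex has degree (number of neighbours) at most 3. -/
def Subcubic (G : SimpleGraph V) : Prop := ∀ v : V, (G.neighborSet v).ncard ≤ 3

/-- Two walks are edge-disjoint if they share no edge. -/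
def WalkEdgeDisjoint {G : SimpleGraph V} {a b c d : V}
    (p : G.Walk a b) (q : G.Walk c d) : Prop :=
  ∀ e, e ∈ p.edges → e ∉ q.edges

/-- A skewed theta: two branch vertices joined by three pairwise edge-disjoint paths,
two of odd length and one of even length. -/
def HasSkewedTheta (G : SimpleGraph V) : Prop :=
  ∃ (a b : V) (p₁ p₂ p₃ : G.Walk a b),
    p₁.IsPath ∧ p₂.IsPath ∧ p₃.IsPath ∧
    WalkEdgeDisjoint p₁ p₂ ∧ WalkEdgeDisjoint p₁ p₃ ∧ WalkEdgeDisjoint p₂ p₃ ∧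
    Odd p₁.length ∧ Odd p₂.length ∧ Even p₃.length

/-- A graph is 2-connected: at least 3 vertices and deleting any vertex leaves it connected. -/
def TwoConnected (G : SimpleGraph V) : Prop :=
  3 ≤ Nat.card V ∧ ∀ v : V, ((⊤ : G.Subgraph).deleteVerts {v}).coe.Connected

/-- Given a bipartition with first class `A`, an edge is `P`-odd if both of its
endvertices lie in the same class. -/
def POdd (A : Set V) (e : Sym2 V) : Prop :=
  (∀ x ∈ e, x ∈ A) ∨ (∀ x ∈ e, x ∉ A)

/-- A stable (independent) set of vertices. -/
def StableSet (G : SimpleGraph V) (s : Set V) : Prop :=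
  s.Pairwise fun a b => ¬ G.Adj a b

/-- `u` is the centre of an induced claw. -/
def HasInducedClawAt (G : SimpleGraph V) (u : V) : Prop :=
  ∃ a b c : V, G.Adj u a ∧ G.Adj u b ∧ G.Adj u c ∧
    a ≠ b ∧ a ≠ c ∧ b ≠ c ∧ ¬ G.Adj a b ∧ ¬ G.Adj a c ∧ ¬ G.Adj b c

/-- A graph is claw-free if it has no induced claw. -/
def ClawFree (G : SimpleGraph V) : Prop := ∀ u : V, ¬ HasInducedClawAt G u

/-- The t-contraction of `G` at a vertex `v`: the neighbours of `v` are removed,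
and `v` becomes adjacent to all former second neighbours. -/
def tContract (G : SimpleGraph V) (v : V) :
    SimpleGraph {w : V // w ∉ G.neighborSet v} :=
  SimpleGraph.fromRel (fun a b =>
    G.Adj a b ∨ ((a : V) = v ∧ ∃ n : V, G.Adj v n ∧ G.Adj n (b : V)))

/-- One step in the formation of a t-minor: delete a vertex, or perform a
t-contraction at a vertex whose neighbourhood is stable. -/
def TStep {W W' : Type u} (G : SimpleGraph W) (H : SimpleGraph W') : Prop :=
  (∃ v : W, Nonempty (H ≃g (G.induce {w : W | w ≠ v}))) ∨
  (∃ v : W, StableSet G (G.neighborSet v) ∧ Nonempty (H ≃g tContract G v))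

/-- `H` is a t-minor of `G` if it is obtained by a series of vertex deletions
and t-contractions. -/
def IsTMinor {W W' : Type u} (G : SimpleGraph W) (H : SimpleGraph W') : Prop :=
  Relation.ReflTransGen (fun a b : (Σ U : Type u, SimpleGraph U) => TStep a.2 b.2)
    ⟨W, G⟩ ⟨W', H⟩

/-- The stable set polytope of `G`: the convex hull of characteristic vectors of stable sets. -/
noncomputable def stableSetPolytope (G : SimpleGraph V) : Set (V → ℝ) :=
  convexHull ℝ {x : V → ℝ | ∃ s : Set V, StableSet G s ∧ x = s.indicator 1}

/-- The polytope given by non-negativity, edge and odd-cycle inequalities. -/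
def TSTAB (G : SimpleGraph V) [Fintype V] : Set (V → ℝ) :=
  {x : V → ℝ |
    (∀ v : V, 0 ≤ x v ∧ x v ≤ 1) ∧
    (∀ u v : V, G.Adj u v → x u + x v ≤ 1) ∧
    (∀ (v : V) (c : G.Walk v v), c.IsCycle → Odd c.length →
      ∑ u ∈ c.support.toFinset, x u ≤ ((c.length / 2 : ℕ) : ℝ))}

/-- A graph is t-perfect if its stable set polytope coincides with `TSTAB`. -/
def TPerfect (G : SimpleGraph V) [Fintype V] : Prop :=
  stableSetPolytope G = TSTAB G

/-- The complete graph on four vertices. -/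
def K4 : SimpleGraph (Fin 4) := ⊤

/-- The 5-wheel: a 5-cycle (on `0,…,4`) plus a hub (`5`) adjacent to all cycle vertices. -/
def W5 : SimpleGraph (Fin 6) :=
  SimpleGraph.fromRel (fun i j =>
    (j : ℕ) = 5 ∨ ((i : ℕ) < 5 ∧ (j : ℕ) < 5 ∧ (j : ℕ) = ((i : ℕ) + 1) % 5))

/-- The 5-cycle. -/
def C5 : SimpleGraph (Fin 5) :=
  SimpleGraph.fromRel (fun i j => (j : ℕ) = ((i : ℕ) + 1) % 5)

/-- An induced path of `G` all of whose vertices lie in `S`. -/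
def IsInducedPathIn (G : SimpleGraph V) (S : Set V) {a b : V} (p : G.Walk a b) : Prop :=
  p.IsPath ∧ (∀ x ∈ p.support, x ∈ S) ∧
    ∀ x y : V, x ∈ p.support → y ∈ p.support → G.Adj x y → s(x, y) ∈ p.edges

/-- The data of a skewed prism: two triangles `x₁x₂x₃`, `y₁y₂y₃` joined by three
vertex-disjoint induced paths `P₁,P₂,P₃`, where `P₁,P₂` are even and `P₃` is odd, and
the triangle edges are the only edges between the paths. -/
def IsSkewedPrism (G : SimpleGraph V) (x₁ x₂ x₃ y₁ y₂ y₃ : V)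
    (P₁ : G.Walk x₁ y₁) (P₂ : G.Walk x₂ y₂) (P₃ : G.Walk x₃ y₃) : Prop :=
  P₁.IsPath ∧ P₂.IsPath ∧ P₃.IsPath ∧
  Even P₁.length ∧ Even P₂.length ∧ Odd P₃.length ∧
  P₁.support.Disjoint P₂.support ∧ P₁.support.Disjoint P₃.support ∧
  P₂.support.Disjoint P₃.support ∧
  G.Adj x₁ x₂ ∧ G.Adj x₁ x₃ ∧ G.Adj x₂ x₃ ∧
  G.Adj y₁ y₂ ∧ G.Adj y₁ y₃ ∧ G.Adj y₂ y₃ ∧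
  (∀ u w : V, u ∈ P₁.support ++ P₂.support ++ P₃.support →
    w ∈ P₁.support ++ P₂.support ++ P₃.support →
    (G.Adj u w ↔ (s(u, w) ∈ P₁.edges ∨ s(u, w) ∈ P₂.edges ∨ s(u, w) ∈ P₃.edges ∨
      s(u, w) ∈ [s(x₁, x₂), s(x₁, x₃), s(x₂, x₃), s(y₁, y₂), s(y₁, y₃), s(y₂, y₃)])))

/-- `G` contains a skewed prism as an induced subgraph. -/
def HasSkewedPrism (G : SimpleGraph V) : Prop :=
  ∃ (x₁ x₂ x₃ y₁ y₂ y₃ : V) (P₁ : G.Walk x₁ y₁) (P₂ : G.Walk x₂ y₂) (P₃ : G.Walk x₃ y₃),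
    IsSkewedPrism G x₁ x₂ x₃ y₁ y₂ y₃ P₁ P₂ P₃

/-- A `u`–`v`-linked obstruction with all vertices inside `S`: four vertex-disjoint
induced paths `R = u…r`, `S' = v…s`, `X = x₁…x₂`, `Y = y₁…y₂` with triangles
`r,x₁,y₁` and `s,x₂,y₂`, the triangle edges being the only edges between the paths,
and `X` of even length. -/
def IsLinkedObstructionIn (G : SimpleGraph V) (S : Set V) (u v : V) : Prop :=
  ∃ (r s x₁ x₂ y₁ y₂ : V) (R : G.Walk u r) (S' : G.Walk v s)
    (X : G.Walk x₁ x₂) (Y : G.Walk y₁ y₂),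
    R.IsPath ∧ S'.IsPath ∧ X.IsPath ∧ Y.IsPath ∧ Even X.length ∧
    (∀ w ∈ R.support, w ∈ S) ∧ (∀ w ∈ S'.support, w ∈ S) ∧
    (∀ w ∈ X.support, w ∈ S) ∧ (∀ w ∈ Y.support, w ∈ S) ∧
    R.support.Disjoint S'.support ∧ R.support.Disjoint X.support ∧
    R.support.Disjoint Y.support ∧ S'.support.Disjoint X.support ∧
    S'.support.Disjoint Y.support ∧ X.support.Disjoint Y.support ∧
    G.Adj r x₁ ∧ G.Adj r y₁ ∧ G.Adj x₁ y₁ ∧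
    G.Adj s x₂ ∧ G.Adj s y₂ ∧ G.Adj x₂ y₂ ∧
    (∀ a b : V, a ∈ R.support ++ S'.support ++ X.support ++ Y.support →
      b ∈ R.support ++ S'.support ++ X.support ++ Y.support →
      (G.Adj a b ↔ (s(a, b) ∈ R.edges ∨ s(a, b) ∈ S'.edges ∨ s(a, b) ∈ X.edges ∨
        s(a, b) ∈ Y.edges ∨
        s(a, b) ∈ [s(r, x₁), s(r, y₁), s(x₁, y₁), s(s, x₂), s(s, y₂), s(x₂, y₂)])))



/-- `p 0, …, p n` is an induced `u`–`v`-path inside `S`. -/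
structure IPth (G : SimpleGraph V) (S : Set V) (u v : V) (n : ℕ) (p : ℕ → V) : Prop where
  h0 : p 0 = u
  hn : p n = v
  mem : ∀ i, i ≤ n → p i ∈ S
  inj : ∀ i j, i ≤ n → j ≤ n → p i = p j → i = j
  adj : ∀ i j, i ≤ n → j ≤ n → (G.Adj (p i) (p j) ↔ (j = i + 1 ∨ i = j + 1))

theorem walk_of_fun (G : SimpleGraph V) (f : ℕ → V) (n : ℕ)
    (inj : ∀ i j, i ≤ n → j ≤ n → f i = f j → i = j)
    (hadj : ∀ i, i < n → G.Adj (f i) (f (i + 1))) :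
    ∃ W : G.Walk (f 0) (f n), W.IsPath ∧ W.length = n ∧
      (∀ x, x ∈ W.support ↔ ∃ i, i ≤ n ∧ f i = x) ∧
      (∀ i, i < n → s(f i, f (i + 1)) ∈ W.edges) := by
  induction n with
  | zero =>
    refine ⟨Walk.nil, by simp, by simp, ?_, by simp⟩
    intro x
    simp [eq_comm]
  | succ n ih =>
    obtain ⟨W, h1, h2, h3, h4⟩ := ih (fun i j hi hj => inj i j (by omega) (by omega))
      (fun i hi => hadj i (by omega))
    refine ⟨W.concat (hadj n (by omega)), ?_, by simp [h2], ?_, ?_⟩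
    · apply h1.concat
      rw [h3]
      rintro ⟨i, hi, h⟩
      have := inj _ _ (by omega) (by omega) h
      omega
    · intro x
      simp only [Walk.support_concat, List.mem_append, List.mem_singleton, h3]
      constructor
      · rintro (⟨i, hi, h⟩ | h)
        · exact ⟨i, by omega, h⟩
        · exact ⟨n + 1, le_rfl, h.symm⟩
      · rintro ⟨i, hi, h⟩
        rcases Nat.lt_or_ge n i with h' | h'
        · have : i = n + 1 := by omega
          subst this
          exact Or.inr h.symm
        · exact Or.inl ⟨i, h', h⟩
    · intro i hi
      simp only [Walk.edges_concat, List.concat_eq_append, List.mem_append, List.mem_singleton]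
      rcases Nat.lt_or_ge i n with h' | h'
      · exact Or.inl (h4 i h')
      · have : i = n := by omega
        subst this
        exact Or.inr rfl

theorem walk_of_fun' (G : SimpleGraph V) (f : ℕ → V) (n : ℕ) (a b : V) (ha : f 0 = a) (hb : f n = b)
    (inj : ∀ i j, i ≤ n → j ≤ n → f i = f j → i = j)
    (hadj : ∀ i, i < n → G.Adj (f i) (f (i + 1))) :
    ∃ W : G.Walk a b, W.IsPath ∧ W.length = n ∧
      (∀ x, x ∈ W.support ↔ ∃ i, i ≤ n ∧ f i = x) ∧
      (∀ i, i < n → s(f i, f (i + 1)) ∈ W.edges) := by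
  subst ha; subst hb
  exact walk_of_fun G f n inj hadj

theorem edges_getVert {G : SimpleGraph V} {a b : V} (p : G.Walk a b) (e : Sym2 V)
    (he : e ∈ p.edges) : ∃ i, i < p.length ∧ e = s(p.getVert i, p.getVert (i + 1)) := by
  induction p with
  | nil => simp at he
  | cons h q ih =>
    simp only [Walk.edges_cons, List.mem_cons] at he
    rcases he with he | he
    · exact ⟨0, by simp, by simp [he]⟩
    · obtain ⟨i, hi, h'⟩ := ih he
      exact ⟨i + 1, by simp; omega, by simpa using h'⟩

theorem ipth_of_walk {G : SimpleGraph V} {S : Set V} {a b : V} (p : G.Walk a b)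
    (hp : IsInducedPathIn G S p) : IPth G S a b p.length p.getVert := by
  obtain ⟨h1, h2, h3⟩ := hp
  have inj : ∀ i j, i ≤ p.length → j ≤ p.length → p.getVert i = p.getVert j → i = j :=
    fun i j hi hj h => h1.getVert_injOn hi hj h
  refine ⟨by simp, by simp, fun i hi => h2 _ (p.getVert_mem_support i), inj, ?_⟩
  intro i j hi hj
  constructor
  · intro h
    obtain ⟨t, ht, h'⟩ := edges_getVert p _
      (h3 _ _ (p.getVert_mem_support i) (p.getVert_mem_support j) h)
    rw [Sym2.eq_iff] at h'
    rcases h' with ⟨ha, hb⟩ | ⟨ha, hb⟩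
    · have := inj _ _ hi (by omega) ha
      have := inj _ _ hj (by omega) hb
      omega
    · have := inj _ _ hi (by omega) ha
      have := inj _ _ hj (by omega) hb
      omega
  · rintro (rfl | rfl)
    · exact p.adj_getVert_succ (by omega)
    · exact (p.adj_getVert_succ (by omega)).symm

set_option maxHeartbeats 4000000 in
/-- The basic configuration giving an obstruction. -/
theorem obstruction_of {G : SimpleGraph V} {S : Set V} {u v : V} {n : ℕ} {p : ℕ → V}
    (hp : IPth G S u v n p) {k : ℕ} {d : ℕ → V} (hd : IPth G S (d 0) (d k) k d)
    (hdp : ∀ s t, s ≤ k → t ≤ n → d s ≠ p t) {i j : ℕ} (hij : i < j) (hj : j < n)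
    (hadj : ∀ s t, s ≤ k → t ≤ n → (G.Adj (d s) (p t) ↔
      ((s = 0 ∧ (t = i ∨ t = i + 1)) ∨ (s = k ∧ (t = j ∨ t = j + 1)))))
    (hev : Even k ∨ Even (j - i - 1)) : IsLinkedObstructionIn G S u v := by
  obtain ⟨R, R1, R2, R3, R4⟩ := walk_of_fun' G p i u (p i) hp.h0 rfl
    (fun a b ha hb => hp.inj a b (by omega) (by omega))
    (fun a ha => (hp.adj _ _ (by omega) (by omega)).2 (Or.inl rfl))
  obtain ⟨T, T1, T2, T3, T4⟩ := walk_of_fun' G (fun t => p (n - t)) (n - j - 1) v (p (j + 1)) hp.hn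
    (by congr 1; omega)
    (fun a b ha hb h => by have := hp.inj _ _ (by omega) (by omega) h; omega)
    (fun a ha => (hp.adj _ _ (by omega) (by omega)).2 (by omega))
  obtain ⟨X, X1, X2, X3, X4⟩ := walk_of_fun' G (fun t => p (i + 1 + t)) (j - i - 1)
    (p (i + 1)) (p j) rfl (by congr 1; omega)
    (fun a b ha hb h => by have := hp.inj _ _ (by omega) (by omega) h; omega)
    (fun a ha => (hp.adj _ _ (by omega) (by omega)).2 (by omega))
  obtain ⟨Y, Y1, Y2, Y3, Y4⟩ := walk_of_fun' G d k (d 0) (d k) rfl rfl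
    hd.inj (fun a ha => (hd.adj _ _ (by omega) (by omega)).2 (by omega))
  have tp : ∀ a, a < n → G.Adj (p a) (p (a + 1)) := fun a ha =>
    (hp.adj _ _ (by omega) (by omega)).2 (Or.inl rfl)
  have t1 : G.Adj (d 0) (p i) := (hadj _ _ (by omega) (by omega)).2 (by omega)
  have t2 : G.Adj (d 0) (p (i + 1)) := (hadj _ _ (by omega) (by omega)).2 (by omega)
  have t3 : G.Adj (d k) (p j) := (hadj _ _ (by omega) (by omega)).2 (by omega)
  have t4 : G.Adj (d k) (p (j + 1)) := (hadj _ _ (by omega) (by omega)).2 (by omega)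
  have dRT : R.support.Disjoint T.support := by
    intro x hx hy
    rw [R3] at hx; rw [T3] at hy
    obtain ⟨a, ha, rfl⟩ := hx; obtain ⟨b, hb, h⟩ := hy
    have := hp.inj _ _ (by omega) (by omega) h; omega
  have dRX : R.support.Disjoint X.support := by
    intro x hx hy
    rw [R3] at hx; rw [X3] at hy
    obtain ⟨a, ha, rfl⟩ := hx; obtain ⟨b, hb, h⟩ := hy
    have := hp.inj _ _ (by omega) (by omega) h; omega
  have dTX : T.support.Disjoint X.support := by
    intro x hx hy
    rw [T3] at hx; rw [X3] at hy
    obtain ⟨a, ha, rfl⟩ := hx; obtain ⟨b, hb, h⟩ := hy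
    have := hp.inj _ _ (by omega) (by omega) h; omega
  have dRY : R.support.Disjoint Y.support := by
    intro x hx hy
    rw [R3] at hx; rw [Y3] at hy
    obtain ⟨a, ha, rfl⟩ := hx; obtain ⟨b, hb, h⟩ := hy
    exact hdp _ _ (by omega) (by omega) h
  have dTY : T.support.Disjoint Y.support := by
    intro x hx hy
    rw [T3] at hx; rw [Y3] at hy
    obtain ⟨a, ha, rfl⟩ := hx; obtain ⟨b, hb, h⟩ := hy
    exact hdp _ _ (by omega) (by omega) h
  have dXY : X.support.Disjoint Y.support := by
    intro x hx hy
    rw [X3] at hx; rw [Y3] at hy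
    obtain ⟨a, ha, rfl⟩ := hx; obtain ⟨b, hb, h⟩ := hy
    exact hdp _ _ (by omega) (by omega) h
  have mR : ∀ w ∈ R.support, w ∈ S := by
    intro x hx
    rw [R3] at hx
    obtain ⟨a, ha, rfl⟩ := hx
    exact hp.mem _ (by omega)
  have mT : ∀ w ∈ T.support, w ∈ S := by
    intro x hx
    rw [T3] at hx
    obtain ⟨a, ha, rfl⟩ := hx
    exact hp.mem _ (by omega)
  have mX : ∀ w ∈ X.support, w ∈ S := by
    intro x hx
    rw [X3] at hx
    obtain ⟨a, ha, rfl⟩ := hx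
    exact hp.mem _ (by omega)
  have mY : ∀ w ∈ Y.support, w ∈ S := by
    intro x hx
    rw [Y3] at hx
    obtain ⟨a, ha, rfl⟩ := hx
    exact hd.mem _ (by omega)
  -- consecutive vertices of `p`
  have ep : ∀ a, a < n → (s(p a, p (a + 1)) ∈ R.edges ∨ s(p a, p (a + 1)) ∈ T.edges ∨
      s(p a, p (a + 1)) ∈ X.edges ∨ s(p a, p (a + 1)) = s(p i, p (i + 1)) ∨
      s(p a, p (a + 1)) = s(p (j + 1), p j)) := by
    intro a ha
    rcases lt_trichotomy a i with h | h | h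
    · exact Or.inl (R4 a h)
    · subst h; simp
    · rcases lt_trichotomy a j with h' | h' | h'
      · have := X4 (a - i - 1) (by omega)
        rw [show i + 1 + (a - i - 1) = a by omega,
          show i + 1 + (a - i - 1 + 1) = a + 1 by omega] at this
        exact Or.inr (Or.inr (Or.inl this))
      · subst h'
        right; right; right; right
        exact Sym2.eq_swap
      · have := T4 (n - a - 1) (by omega)
        simp only [show n - (n - a - 1) = a + 1 by omega,
          show n - (n - a - 1 + 1) = a by omega] at this
        rw [Sym2.eq_swap] at this
        exact Or.inr (Or.inl this)
  have cov : ∀ a, a ∈ R.support ++ T.support ++ X.support ++ Y.support →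
      (∃ t, t ≤ n ∧ a = p t) ∨ (∃ t, t ≤ k ∧ a = d t) := by
    intro a ha
    simp only [List.mem_append, R3, T3, X3, Y3] at ha
    rcases ha with ((⟨b, hb, h⟩ | ⟨b, hb, h⟩) | ⟨b, hb, h⟩) | ⟨b, hb, h⟩
    · exact Or.inl ⟨_, by omega, h.symm⟩
    · exact Or.inl ⟨n - b, by omega, h.symm⟩
    · exact Or.inl ⟨i + 1 + b, by omega, h.symm⟩
    · exact Or.inr ⟨_, by omega, h.symm⟩
  have cov' : ∀ a, a ∈ R.support ++ T.support ++ Y.support ++ X.support →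
      (∃ t, t ≤ n ∧ a = p t) ∨ (∃ t, t ≤ k ∧ a = d t) := by
    intro a ha
    apply cov
    simp only [List.mem_append] at ha ⊢
    tauto
  -- the forward direction for adjacency
  have key : ∀ a b, ((∃ t, t ≤ n ∧ a = p t) ∨ (∃ t, t ≤ k ∧ a = d t)) →
      ((∃ t, t ≤ n ∧ b = p t) ∨ (∃ t, t ≤ k ∧ b = d t)) → G.Adj a b →
      (s(a, b) ∈ R.edges ∨ s(a, b) ∈ T.edges ∨ s(a, b) ∈ X.edges ∨ s(a, b) ∈ Y.edges ∨
        s(a, b) = s(p i, p (i + 1)) ∨ s(a, b) = s(p i, d 0) ∨ s(a, b) = s(p (i + 1), d 0) ∨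
        s(a, b) = s(p (j + 1), p j) ∨ s(a, b) = s(p (j + 1), d k) ∨ s(a, b) = s(p j, d k)) := by
    have mixed : ∀ s t, s ≤ k → t ≤ n → G.Adj (d s) (p t) →
        (s(p t, d s) = s(p i, d 0) ∨ s(p t, d s) = s(p (i + 1), d 0) ∨
        s(p t, d s) = s(p (j + 1), d k) ∨ s(p t, d s) = s(p j, d k)) := by
      intro s t hs ht h
      rcases (hadj s t hs ht).1 h with ⟨rfl, rfl | rfl⟩ | ⟨rfl, rfl | rfl⟩ <;> simp
    rintro a b (⟨t, ht, rfl⟩ | ⟨t, ht, rfl⟩) (⟨t', ht', rfl⟩ | ⟨t', ht', rfl⟩) hab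
    · rcases (hp.adj _ _ ht ht').1 hab with rfl | rfl
      · rcases ep t (by omega) with h | h | h | h | h <;> tauto
      · rw [Sym2.eq_swap]
        rcases ep t' (by omega) with h | h | h | h | h <;> tauto
    · rcases mixed _ _ ht' ht hab.symm with h | h | h | h <;> tauto
    · rw [Sym2.eq_swap]
      rcases mixed _ _ ht ht' hab with h | h | h | h <;> tauto
    · rcases (hd.adj _ _ ht ht').1 hab with rfl | rfl
      · have := Y4 t (by omega)
        tauto
      · have := Y4 t' (by omega)
        rw [Sym2.eq_swap]
        tauto
  rcases hev with hev | hev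
  · refine ⟨p i, p (j + 1), d 0, d k, p (i + 1), p j, R, T, Y, X, R1, T1, Y1, X1, by rwa [Y2],
      mR, mT, mY, mX, dRT, dRY, dRX, dTY, dTX, dXY.symm, t1.symm, tp i (by omega), t2,
      t4.symm, (tp j (by omega)).symm, t3, ?_⟩
    intro a b ha hb
    constructor
    · intro hab
      have := key a b (cov' a ha) (cov' b hb) hab
      simp only [List.mem_cons, List.not_mem_nil, or_false]
      rw [Sym2.eq_swap (a := d 0), Sym2.eq_swap (a := d k)]
      tauto
    · rintro (h | h | h | h | h)
      · exact Walk.adj_of_mem_edges _ h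
      · exact Walk.adj_of_mem_edges _ h
      · exact Walk.adj_of_mem_edges _ h
      · exact Walk.adj_of_mem_edges _ h
      · simp only [List.mem_cons, List.not_mem_nil, or_false] at h
        rw [← SimpleGraph.mem_edgeSet]
        rcases h with h | h | h | h | h | h <;> rw [h, SimpleGraph.mem_edgeSet]
        · exact t1.symm
        · exact tp i (by omega)
        · exact t2
        · exact t4.symm
        · exact (tp j (by omega)).symm
        · exact t3
  · refine ⟨p i, p (j + 1), p (i + 1), p j, d 0, d k, R, T, X, Y, R1, T1, X1, Y1, by rwa [X2],
      mR, mT, mX, mY, dRT, dRX, dRY, dTX, dTY, dXY, tp i (by omega), t1.symm, t2.symm,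
      (tp j (by omega)).symm, t4.symm, t3.symm, ?_⟩
    intro a b ha hb
    constructor
    · intro hab
      have := key a b (cov a ha) (cov b hb) hab
      simp only [List.mem_cons, List.not_mem_nil, or_false]
      tauto
    · rintro (h | h | h | h | h)
      · exact Walk.adj_of_mem_edges _ h
      · exact Walk.adj_of_mem_edges _ h
      · exact Walk.adj_of_mem_edges _ h
      · exact Walk.adj_of_mem_edges _ h
      · simp only [List.mem_cons, List.not_mem_nil, or_false] at h
        rw [← SimpleGraph.mem_edgeSet]
        rcases h with h | h | h | h | h | h <;> rw [h, SimpleGraph.mem_edgeSet]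
        · exact tp i (by omega)
        · exact t1.symm
        · exact t2.symm
        · exact (tp j (by omega)).symm
        · exact t4.symm
        · exact t3.symm

/-- A vertex off an induced path attaches along exactly one edge, or there is an obstruction. -/
theorem attach {G : SimpleGraph V} {S : Set V} {u v : V} (hcf : ClawFree G)
    (hu : ∀ a b, a ∈ S → b ∈ S → G.Adj u a → G.Adj u b → a ≠ b → G.Adj a b)
    (hv : ∀ a b, a ∈ S → b ∈ S → G.Adj v a → G.Adj v b → a ≠ b → G.Adj a b)
    (hno : ¬ IsLinkedObstructionIn G S u v) (huv : u ≠ v)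
    {n : ℕ} {p : ℕ → V} (hp : IPth G S u v n p) {w : V} (hw : w ∈ S)
    (hwp : ∀ t, t ≤ n → w ≠ p t) {t₀ : ℕ} (ht₀ : t₀ ≤ n) (hadj : G.Adj w (p t₀)) :
    ∃ i, i < n ∧ ∀ t, t ≤ n → (G.Adj w (p t) ↔ (t = i ∨ t = i + 1)) := by
  classical
  have hn0 : 0 < n := by
    rcases Nat.eq_zero_or_pos n with h | h
    · subst h
      exact absurd (hp.h0.symm.trans hp.hn) huv
    · exact h
  have nb : ∀ t, t ≤ n → G.Adj w (p t) →
      (t < n ∧ G.Adj w (p (t + 1))) ∨ (0 < t ∧ G.Adj w (p (t - 1))) := by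
    intro t ht h
    rcases Nat.eq_zero_or_pos t with h0 | h0
    · subst h0
      left
      refine ⟨hn0, hu _ _ hw (hp.mem _ (by omega)) (hp.h0 ▸ h.symm) ?_ (hwp _ (by omega))⟩
      rw [← hp.h0]
      exact (hp.adj _ _ (by omega) (by omega)).2 (by omega)
    rcases Nat.lt_or_ge t n with h1 | h1
    · by_contra hcon
      push Not at hcon
      refine hcf (p t) ⟨w, p (t + 1), p (t - 1), h.symm,
        (hp.adj _ _ (by omega) (by omega)).2 (by omega),
        (hp.adj _ _ (by omega) (by omega)).2 (by omega), hwp _ (by omega), hwp _ (by omega),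
        ?_, hcon.1 h1, hcon.2 h0, ?_⟩
      · intro h
        have := hp.inj _ _ (by omega) (by omega) h
        omega
      · rw [hp.adj _ _ (by omega) (by omega)]
        omega
    · have : t = n := by omega
      subst this
      right
      refine ⟨hn0, hv _ _ hw (hp.mem _ (by omega)) (hp.hn ▸ h.symm) ?_ (hwp _ (by omega))⟩
      rw [← hp.hn]
      exact (hp.adj _ _ (by omega) (by omega)).2 (by omega)
  -- the smallest neighbour
  have hex : ∃ t, t ≤ n ∧ G.Adj w (p t) := ⟨t₀, ht₀, hadj⟩
  obtain ⟨i, ⟨hi, hia⟩, himin⟩ : ∃ i, (i ≤ n ∧ G.Adj w (p i)) ∧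
      ∀ t, t ≤ n → G.Adj w (p t) → i ≤ t :=
    ⟨Nat.find hex, Nat.find_spec hex, fun t ht h => Nat.find_min' hex ⟨ht, h⟩⟩
  have hex' : ∃ t, t ≤ n ∧ G.Adj w (p (n - t)) := ⟨n - t₀, by omega, by
    rwa [show n - (n - t₀) = t₀ by omega]⟩
  obtain ⟨m, ⟨hm, hma⟩, hmax⟩ : ∃ m, (m ≤ n ∧ G.Adj w (p m)) ∧
      ∀ t, t ≤ n → G.Adj w (p t) → t ≤ m := by
    refine ⟨n - Nat.find hex', ⟨by omega, (Nat.find_spec hex').2⟩, fun t ht h => ?_⟩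
    have := Nat.find_min' hex' (m := n - t) ⟨by omega, by
      rwa [show n - (n - t) = t by omega]⟩
    omega
  have hi1 : i < n ∧ G.Adj w (p (i + 1)) := by
    rcases nb i hi hia with h | h
    · exact h
    · have := himin _ (by omega) h.2
      omega
  have hm1 : 0 < m ∧ G.Adj w (p (m - 1)) := by
    rcases nb m hm hma with h | h
    · have := hmax _ (by omega) h.2
      omega
    · exact h
  have him := hmax _ (by omega) hi1.2
  rcases Nat.eq_or_lt_of_le him with h | h
  · refine ⟨i, hi1.1, fun t ht => ⟨fun h' => ?_, ?_⟩⟩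
    · have := himin _ ht h'
      have := hmax _ ht h'
      omega
    · rintro (rfl | rfl)
      · exact hia
      · exact hi1.2
  · exfalso
    apply hno
    refine obstruction_of hp (k := 0) (d := fun _ => w) (i := i) (j := m - 1)
      ⟨rfl, rfl, fun _ _ => hw, fun a b ha hb _ => by omega, ?_⟩ ?_ (by omega) (by omega) ?_
      (Or.inl (by simp))
    · intro a b ha hb
      simp
      omega
    · intro s t _ ht
      exact hwp t ht
    · intro s t hs ht
      have hs0 : s = 0 := by omega
      subst hs0
      simp only [true_and]
      constructor
      · intro h'
        have l1 := himin _ ht h'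
        have l2 := hmax _ ht h'
        by_contra hcon
        refine hcf w ⟨p i, p t, p m, hia, h', hma, ?_, ?_, ?_, ?_, ?_, ?_⟩
        · intro h; have := hp.inj _ _ (by omega) (by omega) h; omega
        · intro h; have := hp.inj _ _ (by omega) (by omega) h; omega
        · intro h; have := hp.inj _ _ (by omega) (by omega) h; omega
        · rw [hp.adj _ _ (by omega) (by omega)]; omega
        · rw [hp.adj _ _ (by omega) (by omega)]; omega
        · rw [hp.adj _ _ (by omega) (by omega)]; omega
      · rintro ((rfl | rfl) | (rfl | rfl))
        · exact hia
        · exact hi1.2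
        · exact hm1.2
        · rwa [show m - 1 + 1 = m by omega]

/-- Reroute an induced path along an ear. -/
theorem reroute {G : SimpleGraph V} {S : Set V} {u v : V} {n : ℕ} {p : ℕ → V}
    (hp : IPth G S u v n p) {k : ℕ} {d : ℕ → V} (hd : IPth G S (d 0) (d k) k d)
    (hdp : ∀ s t, s ≤ k → t ≤ n → d s ≠ p t) {i j : ℕ} (hij : i < j) (hj : j < n) (hk : 0 < k)
    (hadj : ∀ s t, s ≤ k → t ≤ n → (G.Adj (d s) (p t) ↔
      ((s = 0 ∧ (t = i ∨ t = i + 1)) ∨ (s = k ∧ (t = j ∨ t = j + 1)))))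
    (hno : ¬ IsLinkedObstructionIn G S u v) :
    ∃ (n' : ℕ) (p' : ℕ → V), IPth G S u v n' p' ∧ (Even n' ↔ Even n) ∧
      ∀ t, t ≤ n' → (∃ s, s ≤ k ∧ p' t = d s) ∨
        ∃ s, s ≤ n ∧ (s ≤ i ∨ j < s) ∧ p' t = p s := by
  have hpar : ¬ (Even k ∨ Even (j - i - 1)) := fun h =>
    hno (obstruction_of hp hd hdp hij hj hadj h)
  rw [Nat.even_iff, Nat.even_iff] at hpar
  let p' : ℕ → V := fun t => if t ≤ i then p t else if t ≤ i + 1 + k then d (t - i - 1)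
    else p (t - (i + 1 + k) + j)
  have e1 : ∀ t, t ≤ i → p' t = p t := fun t h => by simp [p', h]
  have e2 : ∀ t, i < t → t ≤ i + 1 + k → p' t = d (t - i - 1) := fun t h h' => by
    simp only [p']; rw [if_neg (by omega), if_pos h']
  have e3 : ∀ t, i + 1 + k < t → p' t = p (t - (i + 1 + k) + j) := fun t h => by
    simp only [p']; rw [if_neg (by omega), if_neg (by omega)]
  have ca : ∀ t, t ≤ i ∨ (i < t ∧ t ≤ i + 1 + k) ∨ i + 1 + k < t := by omega
  refine ⟨n - (j + 1) + (i + 2 + k), p', ⟨?_, ?_, ?_, ?_, ?_⟩, ?_, ?_⟩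
  · rw [e1 _ (by omega)]; exact hp.h0
  · rw [e3 _ (by omega), ← hp.hn]
    congr 1; omega
  · intro t ht
    rcases ca t with h | h | h
    · rw [e1 _ h]; exact hp.mem _ (by omega)
    · rw [e2 _ h.1 h.2]; exact hd.mem _ (by omega)
    · rw [e3 _ h]; exact hp.mem _ (by omega)
  · intro a b ha hb hab
    rcases ca a with h | h | h <;> rcases ca b with h' | h' | h'
    · rw [e1 _ h, e1 _ h'] at hab
      exact hp.inj _ _ (by omega) (by omega) hab
    · rw [e1 _ h, e2 _ h'.1 h'.2] at hab
      exact absurd hab.symm (hdp _ _ (by omega) (by omega))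
    · rw [e1 _ h, e3 _ h'] at hab
      have := hp.inj _ _ (by omega) (by omega) hab
      omega
    · rw [e2 _ h.1 h.2, e1 _ h'] at hab
      exact absurd hab (hdp _ _ (by omega) (by omega))
    · rw [e2 _ h.1 h.2, e2 _ h'.1 h'.2] at hab
      have := hd.inj _ _ (by omega) (by omega) hab
      omega
    · rw [e2 _ h.1 h.2, e3 _ h'] at hab
      exact absurd hab (hdp _ _ (by omega) (by omega))
    · rw [e3 _ h, e1 _ h'] at hab
      have := hp.inj _ _ (by omega) (by omega) hab
      omega
    · rw [e3 _ h, e2 _ h'.1 h'.2] at hab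
      exact absurd hab.symm (hdp _ _ (by omega) (by omega))
    · rw [e3 _ h, e3 _ h'] at hab
      have := hp.inj _ _ (by omega) (by omega) hab
      omega
  · intro a b ha hb
    rcases ca a with h | h | h <;> rcases ca b with h' | h' | h'
    · rw [e1 _ h, e1 _ h', hp.adj _ _ (by omega) (by omega)]
    · rw [e1 _ h, e2 _ h'.1 h'.2, G.adj_comm, hadj _ _ (by omega) (by omega)]
      omega
    · rw [e1 _ h, e3 _ h', hp.adj _ _ (by omega) (by omega)]
      omega
    · rw [e2 _ h.1 h.2, e1 _ h', hadj _ _ (by omega) (by omega)]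
      omega
    · rw [e2 _ h.1 h.2, e2 _ h'.1 h'.2, hd.adj _ _ (by omega) (by omega)]
      omega
    · rw [e2 _ h.1 h.2, e3 _ h', hadj _ _ (by omega) (by omega)]
      omega
    · rw [e3 _ h, e1 _ h', hp.adj _ _ (by omega) (by omega)]
      omega
    · rw [e3 _ h, e2 _ h'.1 h'.2, G.adj_comm, hadj _ _ (by omega) (by omega)]
      omega
    · rw [e3 _ h, e3 _ h', hp.adj _ _ (by omega) (by omega)]
      omega
  · rw [Nat.even_iff, Nat.even_iff]
    omega
  · intro t ht
    rcases ca t with h | h | h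
    · exact Or.inr ⟨t, by omega, Or.inl h, e1 _ h⟩
    · exact Or.inl ⟨_, by omega, e2 _ h.1 h.2⟩
    · exact Or.inr ⟨_, by omega, Or.inr (by omega), e3 _ h⟩

/-- A sequence avoiding `q a, …, q c` cannot run inside `q` from a neighbour of `q a`
to a neighbour of `q c`. -/
theorem no_run {G : SimpleGraph V} {S : Set V} {u v : V} {m : ℕ} {q : ℕ → V}
    (hq : IPth G S u v m q) {a c : ℕ} (hac : a < c) (hc : c ≤ m) (g : ℕ → V) (L : ℕ)
    (hg : ∀ t, t < L → G.Adj (g t) (g (t + 1)))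
    (hoff : ∀ t s, t ≤ L → a ≤ s → s ≤ c → g t ≠ q s)
    (h0 : G.Adj (g 0) (q a)) (hL : G.Adj (g L) (q c))
    (hin : ∀ t, t ≤ L → ∃ s, s ≤ m ∧ g t = q s) : False := by
  have key : ∀ t, t ≤ L → ∃ s, s < a ∧ g t = q s := by
    intro t
    induction t with
    | zero =>
      intro h
      obtain ⟨s, hs, e⟩ := hin 0 h
      rw [e, hq.adj _ _ hs (by omega)] at h0
      refine ⟨s, ?_, e⟩
      by_contra hcon
      exact hoff 0 s h (by omega) (by omega) e
    | succ t ih =>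
      intro h
      obtain ⟨s, hs, e⟩ := ih (by omega)
      obtain ⟨s', hs', e'⟩ := hin (t + 1) h
      have := hg t (by omega)
      rw [e, e', hq.adj _ _ (by omega) hs'] at this
      refine ⟨s', ?_, e'⟩
      by_contra hcon
      exact hoff (t + 1) s' h (by omega) (by omega) e'
  obtain ⟨s, hs, e⟩ := key L le_rfl
  rw [e, hq.adj _ _ (by omega) hc] at hL
  omega

theorem main_ind [Fintype V] {G : SimpleGraph V} {S : Set V} {u v : V} (hcf : ClawFree G)
    (hk4 : G.CliqueFree 4)
    (hu : ∀ a b, a ∈ S → b ∈ S → G.Adj u a → G.Adj u b → a ≠ b → G.Adj a b)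
    (hv : ∀ a b, a ∈ S → b ∈ S → G.Adj v a → G.Adj v b → a ≠ b → G.Adj a b)
    (hno : ¬ IsLinkedObstructionIn G S u v) (huv : u ≠ v)
    {m : ℕ} {q : ℕ → V} (hq : IPth G S u v m q) :
    ∀ (N n : ℕ) (p : ℕ → V), IPth G S u v n p →
      (p '' Set.Iic n ∪ q '' Set.Iic m).ncard = N → (Even n ↔ Even m) := by
  intro N
  induction N using Nat.strong_induction_on with
  | _ N ih =>
  intro n p hp hN
  classical
  by_cases hsub : ∀ s, s ≤ m → ∃ t, t ≤ n ∧ q s = p t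
  · -- then `q` follows `p`
    have key : ∀ s, s ≤ m → s ≤ n ∧ q s = p s := by
      intro s
      induction s using Nat.strong_induction_on with
      | _ s ihs =>
      intro hs
      obtain ⟨t, ht, e⟩ := hsub s hs
      rcases Nat.eq_zero_or_pos s with h0 | h0
      · subst h0
        exact ⟨by omega, by rw [hp.h0, hq.h0]⟩
      · obtain ⟨l1, e1⟩ := ihs (s - 1) (by omega) (by omega)
        have had := (hq.adj (s - 1) s (by omega) hs).2 (by omega)
        rw [e1, e, hp.adj _ _ l1 ht] at had
        rcases had with h | h
        · have : t = s := by omega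
          subst this
          exact ⟨ht, e⟩
        · exfalso
          obtain ⟨l2, e2⟩ := ihs (s - 2) (by omega) (by omega)
          have hh : t = s - 2 := by omega
          subst hh
          have := hq.inj _ _ (by omega) (by omega) (e.trans e2.symm)
          omega
    obtain ⟨l, e⟩ := key m le_rfl
    have : n = m := hp.inj _ _ le_rfl l (by rw [← e, hp.hn, hq.hn])
    rw [this]
  · push Not at hsub
    -- first vertex off `p`
    obtain ⟨a, ⟨ham, hap⟩, hamin⟩ : ∃ a, (a ≤ m ∧ ∀ t, t ≤ n → q a ≠ p t) ∧
        ∀ b, b < a → ¬ (b ≤ m ∧ ∀ t, t ≤ n → q b ≠ p t) :=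
      ⟨Nat.find hsub, Nat.find_spec hsub, fun b hb => Nat.find_min hsub hb⟩
    have ha0 : 0 < a := by
      rcases Nat.eq_zero_or_pos a with h | h
      · subst h
        exact absurd (hq.h0.trans hp.h0.symm) (hap 0 (by omega))
      · exact h
    have ham' : a < m := by
      rcases Nat.eq_or_lt_of_le ham with h | h
      · subst h
        exact absurd (hq.hn.trans hp.hn.symm) (hap n (by omega))
      · exact h
    obtain ⟨b, hb, eb⟩ : ∃ b, b ≤ n ∧ q (a - 1) = p b := by
      have := hamin (a - 1) (by omega)
      push Not at this
      exact this (by omega)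
    have hab : G.Adj (q a) (p b) := by
      rw [← eb]
      exact (hq.adj _ _ (by omega) (by omega)).2 (by omega)
    obtain ⟨i, hin, hi⟩ := attach hcf hu hv hno huv hp (hq.mem a ham) hap hb hab
    -- the next vertex is off `p` as well
    have hnext : ∀ t, t ≤ n → q (a + 1) ≠ p t := by
      intro t ht e
      have h1 : G.Adj (q a) (p t) := by
        rw [← e]
        exact (hq.adj _ _ (by omega) (by omega)).2 (by omega)
      have h2 : ¬ G.Adj (p b) (p t) := by
        rw [← e, ← eb, hq.adj _ _ (by omega) (by omega)]
        omega
      rw [hp.adj _ _ hb ht] at h2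
      have h3 := (hi t ht).1 h1
      have h4 := (hi b hb).1 hab
      have : b = t := by omega
      subst this
      have := hq.inj _ _ (by omega) (by omega) (eb.trans e.symm)
      omega
    have hne : a + 1 ≠ m := fun h => hnext n le_rfl (by rw [h, hq.hn, hp.hn])
    have hexc : ∃ c, a < c ∧ c ≤ m ∧ ∃ t, t ≤ n ∧ G.Adj (q c) (p t) :=
      ⟨m - 1, by omega, by omega, n, le_rfl, by
        rw [hp.hn, ← hq.hn]
        exact (hq.adj _ _ (by omega) (by omega)).2 (by omega)⟩
    obtain ⟨c, ⟨hac, hcm, tc, htc, hct⟩, hcmin⟩ : ∃ c, (a < c ∧ c ≤ m ∧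
        ∃ t, t ≤ n ∧ G.Adj (q c) (p t)) ∧
        ∀ b, a < b → b < c → ∀ t, t ≤ n → ¬ G.Adj (q b) (p t) := by
      refine ⟨Nat.find hexc, Nat.find_spec hexc, fun b hb hb' t ht h => ?_⟩
      exact Nat.find_min hexc hb' ⟨hb, le_trans hb'.le (Nat.find_spec hexc).2.1, t, ht, h⟩
    have hoff : ∀ s t, a ≤ s → s ≤ c → t ≤ n → q s ≠ p t := by
      intro s t hs hsc ht e
      rcases Nat.eq_or_lt_of_le hs with h | h
      · subst h; exact hap t ht e
      rcases Nat.eq_or_lt_of_le (Nat.succ_le_of_lt h) with h' | h'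
      · subst h'; exact hnext t ht e
      · refine hcmin (s - 1) (by omega) (by omega) t ht ?_
        rw [← e]
        exact (hq.adj _ _ (by omega) (by omega)).2 (by omega)
    obtain ⟨j, hjn, hj⟩ := attach hcf hu hv hno huv hp (hq.mem c hcm)
      (fun t ht => hoff c t hac.le le_rfl ht) htc hct
    have hadjq : ∀ s t, a ≤ s → s ≤ c → t ≤ n → (G.Adj (q s) (p t) ↔
        ((s = a ∧ (t = i ∨ t = i + 1)) ∨ (s = c ∧ (t = j ∨ t = j + 1)))) := by
      intro s t hs hsc ht
      rcases Nat.eq_or_lt_of_le hs with h | h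
      · subst h
        rw [hi t ht]
        omega
      rcases Nat.eq_or_lt_of_le hsc with h' | h'
      · subst h'
        rw [hj t ht]
        omega
      · have := hcmin s h h' t ht
        simp only [this, false_iff]
        omega
    have hpp : ∀ t, t < n → G.Adj (p t) (p (t + 1)) := fun t ht =>
      (hp.adj _ _ (by omega) (by omega)).2 (by omega)
    -- finishing step
    have fin : ∀ (n' : ℕ) (p' : ℕ → V) (lo hi : ℕ), IPth G S u v n' p' → (Even n' ↔ Even n) →
        (∀ t, t ≤ n' → (∃ s, a ≤ s ∧ s ≤ c ∧ p' t = q s) ∨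
          ∃ s, s ≤ n ∧ (s ≤ lo ∨ hi < s) ∧ p' t = p s) →
        (∃ t, lo < t ∧ t ≤ hi ∧ t ≤ n ∧ ∀ s, s ≤ m → p t ≠ q s) → (Even n ↔ Even m) := by
      rintro n' p' lo hi hp' hev hcov ⟨t, h1, h2, h3, h4⟩
      rw [← hev]
      refine ih _ ?_ n' p' hp' rfl
      rw [← hN]
      apply Set.ncard_lt_ncard
      · refine ⟨?_, ?_⟩
        · rintro x (⟨y, hy, rfl⟩ | hx)
          · rcases hcov y hy with ⟨s, _, hs, e⟩ | ⟨s, hs, _, e⟩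
            · exact Or.inr ⟨s, by simp; omega, e.symm⟩
            · exact Or.inl ⟨s, hs, e.symm⟩
          · exact Or.inr hx
        · intro hsub
          rcases hsub (Or.inl ⟨t, h3, rfl⟩) with ⟨y, hy, e⟩ | ⟨y, hy, e⟩
          · rcases hcov y hy with ⟨s, hs1, hs, e'⟩ | ⟨s, hs, hs', e'⟩
            · exact h4 s (by omega) (e.symm.trans e')
            · have := hp.inj _ _ h3 hs (e.symm.trans e')
              omega
          · exact h4 y hy e.symm
      · exact Set.toFinite _
    rcases lt_trichotomy i j with hij | hij | hij
    · obtain ⟨n', p', hp', hev, hcov⟩ := reroute hp (k := c - a) (d := fun s => q (a + s))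
        (i := i) (j := j)
        ⟨rfl, rfl, fun s hs => hq.mem _ (by omega),
          fun s t hs ht h => by have := hq.inj _ _ (by omega) (by omega) h; omega,
          fun s t hs ht => by rw [hq.adj _ _ (by omega) (by omega)]; omega⟩
        (fun s t hs ht => hoff _ _ (by omega) (by omega) ht) hij hjn (by omega)
        (fun s t hs ht => by rw [hadjq _ _ (by omega) (by omega) ht]; omega) hno
      refine fin n' p' i j hp' hev ?_ ?_
      · intro t ht
        rcases hcov t ht with ⟨s, hs, e⟩ | h
        · exact Or.inl ⟨a + s, by omega, by omega, e⟩
        · exact Or.inr h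
      · by_contra hcon
        push Not at hcon
        refine no_run hq hac hcm (fun t => p (i + 1 + t)) (j - i - 1) ?_ ?_ ?_ ?_ ?_
        · intro t ht
          exact hpp _ (by omega)
        · intro t s ht h1 h2 e
          exact hoff s _ h1 h2 (by omega) e.symm
        · exact ((hi _ (by omega)).2 (by omega)).symm
        · exact ((hj _ (by omega)).2 (by omega)).symm
        · intro t ht
          exact hcon _ (by omega) (by omega) (by omega)
    · exfalso
      subst hij
      have a1 := (hi i (by omega)).2 (by omega)
      have a2 := (hi (i + 1) (by omega)).2 (by omega)
      have c1 := (hj i (by omega)).2 (by omega)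
      have c2 := (hj (i + 1) (by omega)).2 (by omega)
      have hqne : q a ≠ q c := fun h => by
        have := hq.inj _ _ (by omega) (by omega) h
        omega
      by_cases had : G.Adj (q a) (q c)
      · apply hk4 {q a, q c, p i, p (i + 1)}
        have a3 := hpp i hin
        rw [SimpleGraph.isNClique_iff]
        constructor
        · simp [SimpleGraph.isClique_iff, Set.pairwise_insert_of_symm, a1, a2, c1, c2,
            had, a3]
        · rw [Finset.card_insert_of_notMem, Finset.card_insert_of_notMem,
            Finset.card_insert_of_notMem, Finset.card_singleton]
          · simpa using a3.ne
          · simp [c1.ne, c2.ne]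
          · simp [had.ne, a1.ne, a2.ne]
      · rcases Nat.eq_zero_or_pos i with h0 | h0
        · subst h0
          rw [hp.h0] at a1 c1
          exact had (hu _ _ (hq.mem _ ham) (hq.mem _ hcm) a1.symm c1.symm hqne)
        · refine hcf (p i) ⟨q a, q c, p (i - 1), a1.symm, c1.symm,
            (hp.adj _ _ (by omega) (by omega)).2 (by omega), hqne,
            hoff _ _ (by omega) (by omega) (by omega), hoff _ _ (by omega) (by omega) (by omega),
            had, ?_, ?_⟩
          · rw [hi _ (by omega)]; omega
          · rw [hj _ (by omega)]; omega
    · obtain ⟨n', p', hp', hev, hcov⟩ := reroute hp (k := c - a) (d := fun s => q (c - s))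
        (i := j) (j := i)
        ⟨rfl, rfl, fun s hs => hq.mem _ (by omega),
          fun s t hs ht h => by have := hq.inj _ _ (by omega) (by omega) h; omega,
          fun s t hs ht => by rw [hq.adj _ _ (by omega) (by omega)]; omega⟩
        (fun s t hs ht => hoff _ _ (by omega) (by omega) ht) hij hin (by omega)
        (fun s t hs ht => by rw [hadjq _ _ (by omega) (by omega) ht]; omega) hno
      refine fin n' p' j i hp' hev ?_ ?_
      · intro t ht
        rcases hcov t ht with ⟨s, hs, e⟩ | h
        · exact Or.inl ⟨c - s, by omega, by omega, e⟩
        · exact Or.inr h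
      · by_contra hcon
        push Not at hcon
        refine no_run hq hac hcm (fun t => p (i - t)) (i - j - 1) ?_ ?_ ?_ ?_ ?_
        · intro t ht
          exact (hp.adj _ _ (by omega) (by omega)).2 (by omega)
        · intro t s ht h1 h2 e
          exact hoff s _ h1 h2 (by omega) e.symm
        · exact ((hi _ (by omega)).2 (by omega)).symm
        · exact ((hj _ (by omega)).2 (by omega)).symm
        · intro t ht
          exact hcon _ (by omega) (by omega) (by omega)

/-- A terminal of the separation has its neighbours in `V₁` forming a clique. -/
theorem end_clique {G : SimpleGraph V} (hcf : ClawFree G) (h2 : TwoConnected G)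
    (V₁ V₂ : Set V) (hunion : V₁ ∪ V₂ = Set.univ)
    (hprop₁ : V₁ ≠ Set.univ)
    (hedges : ∀ e ∈ G.edgeSet, (∀ x ∈ e, x ∈ V₁) ∨ (∀ x ∈ e, x ∈ V₂))
    (u v : V) (huv : u ≠ v) (hsep : V₁ ∩ V₂ = {u, v}) (hna : ¬ G.Adj u v) :
    ∀ a b, a ∈ V₁ → b ∈ V₁ → G.Adj u a → G.Adj u b → a ≠ b → G.Adj a b := by
  have hu1 : u ∈ V₁ ∩ V₂ := by rw [hsep]; simp
  have hv1 : v ∈ V₁ ∩ V₂ := by rw [hsep]; simp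
  have cross : ∀ x y, G.Adj x y → x ∈ V₁ → y ∉ V₁ → x = u ∨ x = v := by
    intro x y hxy hx hy
    rcases hedges s(x, y) hxy with h | h
    · exact absurd (h y (by simp)) hy
    · have : x ∈ V₁ ∩ V₂ := ⟨hx, h x (by simp)⟩
      rw [hsep] at this
      simpa using this
  obtain ⟨z, hz⟩ : ∃ z, z ∉ V₁ := by
    by_contra h
    push Not at h
    exact hprop₁ (Set.eq_univ_of_forall h)
  have hzv : z ≠ v := fun h => hz (h ▸ hv1.1)
  have hc := h2.2 v
  obtain ⟨W⟩ := hc.preconnected ⟨u, by simp [huv]⟩ ⟨z, by simp [hzv]⟩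
  obtain ⟨e, _, he1, he2⟩ := W.exists_boundary_dart {x | (x : V) ∈ V₁} hu1.1 hz
  have hadj := e.adj
  have hfst : (e.fst : V) ≠ v := by
    have := e.fst.2
    simp at this
    exact this
  have hG : G.Adj (e.fst : V) (e.snd : V) := (Subgraph.coe_adj_sub _ _ _ hadj)
  have hfu : (e.fst : V) = u := (cross _ _ hG he1 he2).resolve_right hfst
  rw [hfu] at hG
  set w : V := (e.snd : V) with hw
  have hwV : w ∉ V₁ := he2
  intro a b ha hb hua hub hab
  by_contra hcon
  have nw : ∀ x, x ∈ V₁ → G.Adj u x → x ≠ w ∧ ¬ G.Adj x w := by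
    intro x hx hux
    refine ⟨fun h => hwV (h ▸ hx), fun h => ?_⟩
    rcases cross _ _ h hx hwV with rfl | rfl
    · exact G.loopless.irrefl _ hux
    · exact hna hux
  exact hcf u ⟨a, b, w, hua, hub, hG, hab, (nw a ha hua).1, (nw b hb hub).1, hcon,
    (nw a ha hua).2, (nw b hb hub).2⟩


/-- let `G` be claw-free, `K₄`-free, 2-connected of maximum degree at
most 4, with a separation `(G₁,G₂)` with `V(G₁) ∩ V(G₂) = {u,v}`. If `G₁` contains two
induced `u`–`v`-paths of distinct parities, then `G₁` contains a `u`–`v`-linked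
obstruction. -/
theorem stmt_14 {V : Type u} [Fintype V] (G : SimpleGraph V)
    (hcf : ClawFree G) (hk4 : G.CliqueFree 4) (h2 : TwoConnected G)
    (hdeg : ∀ w : V, (G.neighborSet w).ncard ≤ 4)
    (V₁ V₂ : Set V) (hunion : V₁ ∪ V₂ = Set.univ)
    (hprop₁ : V₁ ≠ Set.univ) (hprop₂ : V₂ ≠ Set.univ)
    (hedges : ∀ e ∈ G.edgeSet, (∀ x ∈ e, x ∈ V₁) ∨ (∀ x ∈ e, x ∈ V₂))
    (u v : V) (huv : u ≠ v) (hsep : V₁ ∩ V₂ = {u, v})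
    (hpaths : ∃ (p q : G.Walk u v), IsInducedPathIn G V₁ p ∧ IsInducedPathIn G V₁ q ∧
      Odd p.length ∧ Even q.length) :
    IsLinkedObstructionIn G V₁ u v := by
  obtain ⟨p, q, hp, hq, hpo, hqe⟩ := hpaths
  have ip := ipth_of_walk p hp
  have iq := ipth_of_walk q hq
  have hna : ¬ G.Adj u v := by
    intro h
    have h' := iq.adj 0 q.length (by omega) (by omega)
    rw [iq.h0, iq.hn] at h'
    have h'' := h'.1 h
    rw [Nat.even_iff] at hqe
    omega
  have hu := end_clique hcf h2 V₁ V₂ hunion hprop₁ hedges u v huv hsep hna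
  have hv := end_clique hcf h2 V₁ V₂ hunion hprop₁ hedges v u huv.symm
    (by rw [hsep, Set.pair_comm]) (fun h => hna h.symm)
  by_contra hno
  have := main_ind hcf hk4 hu hv hno huv iq _ _ _ ip rfl
  exact (Nat.not_even_iff_odd.2 hpo) (this.2 hqe)
end

section
/- The line graph of a graph G is t-perfect if and only if G is subcubic and contains no skewed theta. -/
open SimpleGraph

attribute [local instance] Classical.propDecidable

universe u

variable {V : Type u}

section Generic
variable {W : Type*} {H : SimpleGraph W}

theorem cyc_support_toFinset {v : W} (c : H.Walk v v) (hc : c.IsCycle) :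
    c.support.toFinset = (Finset.range c.length).image c.getVert := by
  ext u
  simp only [List.mem_toFinset, Finset.mem_image, Finset.mem_range,
    Walk.mem_support_iff_exists_getVert]
  constructor
  · rintro ⟨n, hn, hl⟩
    rcases hl.lt_or_eq with h | h
    · exact ⟨n, h, hn⟩
    · refine ⟨0, ?_, ?_⟩
      · have := hc.three_le_length; omega
      · rw [← hn, h]; simp
  · rintro ⟨n, hn, hl⟩
    exact ⟨n, hl, hn.le⟩

theorem cyc_injOn {v : W} (c : H.Walk v v) (hc : c.IsCycle) :
    Set.InjOn c.getVert (Finset.range c.length : Set ℕ) := by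
  intro i hi j hj h
  simp only [Finset.coe_range, Set.mem_Iio] at hi hj
  exact hc.getVert_injOn' (by simp; omega) (by simp; omega) h

theorem cyc_sum {M : Type*} [AddCommMonoid M] {v : W} (c : H.Walk v v) (hc : c.IsCycle)
    (x : W → M) :
    ∑ u ∈ c.support.toFinset, x u = ∑ i ∈ Finset.range c.length, x (c.getVert i) := by
  rw [cyc_support_toFinset c hc, Finset.sum_image (cyc_injOn c hc)]

theorem cyc_sum_shift {M : Type*} [AddCommGroup M] {v : W} (c : H.Walk v v) (x : W → M) :
    ∑ i ∈ Finset.range c.length, x (c.getVert (i + 1)) =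
      ∑ i ∈ Finset.range c.length, x (c.getVert i) := by
  have h := Finset.sum_range_succ' (fun i => x (c.getVert i)) c.length
  rw [Finset.sum_range_succ] at h
  simpa using h.symm

theorem stab_subset_tstab [Fintype W] : stableSetPolytope H ⊆ TSTAB H := by
  apply convexHull_min
  · rintro x ⟨s, hs, rfl⟩
    have h01 : ∀ v, (s.indicator 1 v : ℝ) = if v ∈ s then 1 else 0 := by
      intro v; simp [Set.indicator_apply]
    have hadj : ∀ u v, H.Adj u v →
        (if u ∈ s then 1 else 0) + (if v ∈ s then 1 else 0) ≤ (1 : ℤ) := by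
      intro u v huv
      by_cases hu : u ∈ s <;> by_cases hv : v ∈ s <;> simp [hu, hv]
      exact hs hu hv huv.ne huv
    refine ⟨?_, ?_, ?_⟩
    · intro v; rw [h01]; split_ifs <;> norm_num
    · intro u v huv; rw [h01, h01]; exact_mod_cast hadj u v huv
    · intro v c hc ho
      rw [cyc_sum c hc]
      have h1 : 2 * ∑ i ∈ Finset.range c.length, (if c.getVert i ∈ s then (1:ℤ) else 0)
          ≤ c.length := by
        have hsh := cyc_sum_shift c (fun v => if v ∈ s then (1:ℤ) else 0)
        rw [two_mul]
        nth_rewrite 2 [← hsh]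
        rw [← Finset.sum_add_distrib]
        calc _ ≤ ∑ i ∈ Finset.range c.length, (1:ℤ) := by
              apply Finset.sum_le_sum
              intro i hi
              exact hadj _ _ (c.adj_getVert_succ (by simpa using hi))
          _ = _ := by simp
      have h2 : ∑ i ∈ Finset.range c.length, (if c.getVert i ∈ s then (1:ℤ) else 0)
          ≤ ((c.length / 2 : ℕ) : ℤ) := by omega
      simp only [h01]
      exact_mod_cast h2
  · intro x hx y hy a b ha hb hab
    refine ⟨?_, ?_, ?_⟩
    · intro v
      have h1 := hx.1 v
      have h2 := hy.1 v
      simp only [Pi.add_apply, Pi.smul_apply, smul_eq_mul]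
      constructor
      · have := mul_nonneg ha h1.1; have := mul_nonneg hb h2.1; linarith
      · nlinarith
    · intro u v huv
      have h1 := hx.2.1 u v huv
      have h2 := hy.2.1 u v huv
      simp only [Pi.add_apply, Pi.smul_apply, smul_eq_mul]
      nlinarith
    · intro v c hc ho
      have h1 := hx.2.2 v c hc ho
      have h2 := hy.2.2 v c hc ho
      simp only [Pi.add_apply, Pi.smul_apply, smul_eq_mul, Finset.sum_add_distrib,
        ← Finset.mul_sum]
      calc _ ≤ a * ((c.length / 2 : ℕ) : ℝ) + b * ((c.length / 2 : ℕ) : ℝ) := by gcongr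
        _ = _ := by rw [← add_mul, hab, one_mul]

/-- A linear inequality valid for all stable sets is valid on the stable set polytope. -/
theorem stab_le [Fintype W] (a : W → ℝ) (β : ℝ)
    (h : ∀ s, StableSet H s → ∑ v, a v * (s.indicator 1 v : ℝ) ≤ β)
    (x : W → ℝ) (hx : x ∈ stableSetPolytope H) : ∑ v, a v * x v ≤ β := by
  have : stableSetPolytope H ⊆ {x | ∑ v, a v * x v ≤ β} := by
    apply convexHull_min
    · rintro x ⟨s, hs, rfl⟩; exact h s hs
    · intro x hx y hy p q hp hq hpq
      simp only [Set.mem_ofPred_eq] at *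
      have : ∑ v, a v * (p • x + q • y) v = p * ∑ v, a v * x v + q * ∑ v, a v * y v := by
        simp only [Pi.add_apply, Pi.smul_apply, smul_eq_mul, Finset.mul_sum,
          ← Finset.sum_add_distrib]
        apply Finset.sum_congr rfl; intros; ring
      rw [this]
      calc _ ≤ p * β + q * β := by gcongr
        _ = _ := by rw [← add_mul, hpq, one_mul]
  exact this hx

theorem seq_walk (f : ℕ → W) (n : ℕ) (h : ∀ i < n, H.Adj (f i) (f (i + 1))) :
    ∃ p : H.Walk (f 0) (f n), p.length = n ∧ ∀ i ≤ n, p.getVert i = f i := by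
  induction n with
  | zero => exact ⟨Walk.nil, rfl, by simp⟩
  | succ n ih =>
    obtain ⟨p, hp, hg⟩ := ih (fun i hi => h i (by omega))
    refine ⟨p.concat (h n (by omega)), by simp [hp], ?_⟩
    intro i hi
    rw [Walk.concat, Walk.getVert_append']
    split_ifs with hlt
    · exact hg i (by omega)
    · have : i = n + 1 := by rw [hp] at hlt; omega
      subst this
      simp [hp]

theorem seq_path (f : ℕ → W) (n : ℕ) (h : ∀ i < n, H.Adj (f i) (f (i + 1)))
    (hi : ∀ i ≤ n, ∀ j ≤ n, f i = f j → i = j) :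
    ∃ p : H.Walk (f 0) (f n), p.IsPath ∧ p.length = n ∧ ∀ i ≤ n, p.getVert i = f i := by
  obtain ⟨p, hp, hg⟩ := seq_walk f n h
  refine ⟨p, ?_, hp, hg⟩
  rw [← Walk.IsPath.getVert_injOn_iff]
  intro i hi' j hj' hij
  simp only [Set.mem_ofPred_eq, hp] at hi' hj'
  rw [hg i hi', hg j hj'] at hij
  exact hi i hi' j hj' hij

theorem seq_cycle (f : ℕ → W) (n : ℕ) (hn : 2 ≤ n) (h : ∀ i < n, H.Adj (f i) (f (i + 1)))
    (hi : ∀ i ≤ n, ∀ j ≤ n, f i = f j → i = j) (hc : H.Adj (f n) (f 0)) :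
    ∃ c : H.Walk (f n) (f n), c.IsCycle ∧ c.length = n + 1 ∧
      ∀ u, u ∈ c.support ↔ ∃ i ≤ n, f i = u := by
  obtain ⟨p, hp, hl, hg⟩ := seq_path f n h hi
  refine ⟨Walk.cons hc p, ?_, by simp [hl], ?_⟩
  · rw [Walk.cons_isCycle_iff]
    refine ⟨hp, ?_⟩
    rw [Walk.mk_mem_edges_iff_exists]
    rintro ⟨i, hil, he⟩
    rw [hl] at hil
    rw [hg i (by omega), hg (i+1) (by omega), Sym2.eq_iff] at he
    rcases he with ⟨h1, h2⟩ | ⟨h1, h2⟩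
    · have := hi _ (by omega) _ (by omega) h1; omega
    · have := hi _ (by omega) _ (by omega) h1
      have := hi _ (by omega) _ (by omega) h2; omega
  · intro u
    rw [Walk.support_cons, List.mem_cons, Walk.mem_support_iff_exists_getVert]
    constructor
    · rintro (rfl | ⟨k, hk, hk'⟩)
      · exact ⟨n, le_rfl, rfl⟩
      · exact ⟨k, by omega, by rw [← hk, hg k (by omega)]⟩
    · rintro ⟨k, hk, rfl⟩
      exact Or.inr ⟨k, hg k hk, by omega⟩

end Generic

section LG
variable {V : Type u} {G : SimpleGraph V}

/-- A cycle of `G` gives a cycle of the line graph through exactly its edges. -/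
theorem lg_cycle {v : V} (c : G.Walk v v) (hc : c.IsCycle) :
    ∃ (e : G.edgeSet) (d : G.lineGraph.Walk e e), d.IsCycle ∧ d.length = c.length ∧
      ∀ f : G.edgeSet, f ∈ d.support ↔ (f : Sym2 V) ∈ c.edges := by
  have h3 := hc.three_le_length
  obtain ⟨n, hn⟩ : ∃ n, c.length = n + 1 := ⟨c.length - 1, by omega⟩
  have hnd : c.edges.Nodup := hc.edges_nodup
  have hlen : c.edges.length = n + 1 := by simp [hn]
  have e0 : G.edgeSet := ⟨c.edges[0], c.edges_subset_edgeSet (List.getElem_mem _)⟩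
  let f : ℕ → G.edgeSet := fun i =>
    if h : i < c.edges.length then ⟨c.edges[i], c.edges_subset_edgeSet (List.getElem_mem _)⟩
    else e0
  have hf : ∀ i (h : i < c.edges.length), ((f i : G.edgeSet) : Sym2 V) = c.edges[i] := by
    intro i h; simp only [f, dif_pos h]
  have hf' : ∀ i, i ≤ n → ((f i : G.edgeSet) : Sym2 V) = s(c.getVert i, c.getVert (i+1)) := by
    intro i h; rw [hf i (by omega), Walk.getElem_edges]
  have hinj : ∀ i ≤ n, ∀ j ≤ n, f i = f j → i = j := by
    intro i hi j hj hij
    have := congrArg (Subtype.val) hij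
    rw [hf i (by omega), hf j (by omega)] at this
    exact (hnd.getElem_inj_iff).1 this
  obtain ⟨d, hd, hl, hs⟩ := seq_cycle (H := G.lineGraph) f n (by omega)
    (by
      intro i hi
      rw [lineGraph_adj_iff_exists]
      refine ⟨fun h => ?_, c.getVert (i+1), ?_, ?_⟩
      · have := hinj _ (by omega) _ (by omega) h; omega
      · rw [hf' i (by omega)]; simp
      · rw [hf' (i+1) (by omega)]; simp)
    hinj
    (by
      rw [lineGraph_adj_iff_exists]
      refine ⟨fun h => ?_, v, ?_, ?_⟩
      · have := hinj _ (by omega) _ (by omega) h; omega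
      · rw [hf' n (by omega), ← hn]; simp
      · rw [hf' 0 (by omega)]; simp)
  refine ⟨_, d, hd, by omega, ?_⟩
  intro e
  rw [hs, List.mem_iff_getElem]
  constructor
  · rintro ⟨i, hi, rfl⟩
    exact ⟨i, by omega, (hf i (by omega)).symm⟩
  · rintro ⟨i, hi, he⟩
    exact ⟨i, by omega, Subtype.ext ((hf i hi).trans he)⟩

end LG


section Fwd
variable {V : Type u} {G : SimpleGraph V}

theorem subcubic_of_tperfect [Fintype V] (h : TPerfect G.lineGraph) : Subcubic G := by
  intro v
  by_contra hlt
  push Not at hlt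
  have h4 : 4 ≤ (G.neighborSet v).toFinset.card := by
    rw [← Set.ncard_eq_toFinset_card']; omega
  obtain ⟨t, ht, htc⟩ := Finset.exists_subset_card_eq h4
  have hta : ∀ u ∈ t, G.Adj v u := fun u hu => by
    have := ht hu
    simpa using this
  let φ : {u // u ∈ t} → G.edgeSet := fun u => ⟨s(v, u.1), hta u.1 u.2⟩
  have hφ : Function.Injective φ := by
    intro a b hab
    have h1 := congrArg Subtype.val hab
    simp only [φ] at h1
    exact Subtype.ext (Sym2.congr_right.1 h1)
  let S : Finset G.edgeSet := t.attach.image φ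
  have hS : S.card = 4 := by
    rw [Finset.card_image_of_injective _ hφ, Finset.card_attach, htc]
  have hSv : ∀ e ∈ S, v ∈ (e : Sym2 V) := by
    intro e he
    obtain ⟨u, -, rfl⟩ := Finset.mem_image.1 he
    simp [φ]
  let x : G.edgeSet → ℝ := fun e => if e ∈ S then 1/3 else 0
  have hx0 : ∀ e, 0 ≤ x e := fun e => by simp only [x]; split_ifs <;> norm_num
  have hx1 : ∀ e, x e ≤ 1/3 := fun e => by simp only [x]; split_ifs <;> norm_num
  have hsum : ∑ e, x e = 4/3 := by
    simp only [x, Finset.sum_ite_mem, Finset.univ_inter, Finset.sum_const, hS]; norm_num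
  have hxT : x ∈ TSTAB G.lineGraph := by
    refine ⟨fun e => ⟨hx0 e, (hx1 e).trans (by norm_num)⟩, fun e f _ => ?_, ?_⟩
    · linarith [hx1 e, hx1 f]
    · intro e c hc ho
      have h3 := hc.three_le_length
      by_cases h5 : c.length = 3
      · rw [cyc_sum c hc, h5]
        simp only [Finset.sum_range_succ, Finset.sum_range_zero]
        norm_num
        linarith [hx1 (c.getVert 0), hx1 (c.getVert 1), hx1 (c.getVert 2), hx1 e]
      · have h6 : 2 ≤ c.length / 2 := by
          obtain ⟨k, hk⟩ := ho; omega
        have h7 : (2:ℝ) ≤ ((c.length / 2 : ℕ) : ℝ) := by exact_mod_cast h6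
        refine le_trans (Finset.sum_le_sum_of_subset_of_nonneg (Finset.subset_univ _)
          (fun i _ _ => hx0 i)) ?_
        linarith
  have hxS : x ∈ stableSetPolytope G.lineGraph := by rw [show stableSetPolytope G.lineGraph = _ from h]; exact hxT
  have := stab_le (H := G.lineGraph) (fun e => if e ∈ S then 1 else 0) 1 (by
    intro s hs
    have : ∑ e, (if e ∈ S then (1:ℝ) else 0) * (s.indicator 1 e : ℝ)
        = ((S.filter (· ∈ s)).card : ℝ) := by
      rw [Finset.card_filter]
      push_cast
      simp only [ite_mul, one_mul, zero_mul, Finset.sum_ite_mem, Finset.univ_inter]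
      apply Finset.sum_congr rfl
      intro e _
      simp [Set.indicator_apply]
    rw [this]
    have : (S.filter (· ∈ s)).card ≤ 1 := by
      rw [Finset.card_le_one]
      intro a ha b hb
      simp only [Finset.mem_filter] at ha hb
      by_contra hab
      exact hs ha.2 hb.2 hab (lineGraph_adj_iff_exists.2 ⟨hab, v, hSv a ha.1, hSv b hb.1⟩)
    exact_mod_cast this) x hxS
  have h2 : ∑ e, (if e ∈ S then (1:ℝ) else 0) * x e = ∑ e, x e := by
    apply Finset.sum_congr rfl
    intro e _
    simp only [x]; split_ifs <;> simp
  rw [h2, hsum] at this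
  norm_num at this

end Fwd


section Theta

theorem slack_sum (L : ℕ) (hL : Odd L) (y g : ℕ → ℤ) (hy : y L = y 0) (hg : g L = g 0)
    (h : ∀ i < L, (g i = g (i+1) ∧ y i + y (i+1) = 3) ∨ (g i ≠ g (i+1) ∧ y i + y (i+1) ≤ 2)) :
    2 * ∑ i ∈ Finset.range L, y i ≤ 3 * L - 3 := by
  have hsh : ∑ i ∈ Finset.range L, y (i + 1) = ∑ i ∈ Finset.range L, y i := by
    have h := Finset.sum_range_succ' y L
    rw [Finset.sum_range_succ, hy] at h
    linarith
  have h2 : 2 * ∑ i ∈ Finset.range L, y i = ∑ i ∈ Finset.range L, (y i + y (i+1)) := by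
    rw [Finset.sum_add_distrib, hsh]; ring
  let J := (Finset.range L).filter (fun i => g i ≠ g (i+1))
  have h3 : ∑ i ∈ Finset.range L, (y i + y (i+1)) ≤ 3 * L - J.card := by
    have : (3 * L - J.card : ℤ) = ∑ i ∈ Finset.range L, (3 - if g i ≠ g (i+1) then 1 else 0) := by
      rw [Finset.sum_sub_distrib, Finset.card_filter]
      simp [mul_comm]
    rw [this]
    apply Finset.sum_le_sum
    intro i hi
    rcases h i (by simpa using hi) with h | h
    · simp [h.1, h.2]
    · simp only [ne_eq, h.1, not_false_eq_true, if_true]; linarith [h.2]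
  by_cases hJ : 2 ≤ J.card
  · have := hL
    obtain ⟨k, hk⟩ := hL
    omega
  · exfalso
    have hJ0 : J = ∅ := by
      by_contra hne
      have h1 : J.card = 1 := by
        have := Finset.card_pos.2 (Finset.nonempty_iff_ne_empty.2 hne)
        omega
      obtain ⟨i0, hi0⟩ := Finset.card_eq_one.1 h1
      have hmem : i0 ∈ J := by simp [hi0]
      simp only [J, Finset.mem_filter, Finset.mem_range] at hmem
      have ht := Finset.sum_range_sub g L
      rw [Finset.sum_eq_single i0, hg] at ht
      · exact hmem.2 (by linarith)
      · intro b hb hbi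
        by_contra hb2
        have : b ∈ J := by
          simp only [J, Finset.mem_filter]
          exact ⟨hb, fun h => hb2 (by rw [h]; ring)⟩
        rw [hi0] at this
        exact hbi (by simpa using this)
      · intro hb; simp at hb; omega
    have h4 : ∑ i ∈ Finset.range L, (y i + y (i+1)) = ∑ i ∈ Finset.range L, (3:ℤ) := by
      apply Finset.sum_congr rfl
      intro i hi
      rcases h i (by simpa using hi) with h | h
      · exact h.2
      · exfalso
        have : i ∈ J := by simp only [J, Finset.mem_filter]; exact ⟨hi, h.1⟩
        simp [hJ0] at this
    rw [← h2] at h4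
    simp at h4
    obtain ⟨k, hk⟩ := hL
    omega

variable {V : Type u} {G : SimpleGraph V}

theorem four_nbrs [Finite V] (hG : Subcubic G) {v a b c d : V} (ha : G.Adj v a) (hb : G.Adj v b)
    (hc : G.Adj v c) (hd : G.Adj v d) (hab : a ≠ b) (hac : a ≠ c) (had : a ≠ d)
    (hbc : b ≠ c) (hbd : b ≠ d) (hcd : c ≠ d) : False := by
  have h := hG v
  have hs : ({a, b, c, d} : Set V) ⊆ G.neighborSet v := by
    intro x hx
    simp only [Set.mem_insert_iff, Set.mem_singleton_iff] at hx
    rcases hx with rfl | rfl | rfl | rfl <;> assumption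
  have h4 := Set.ncard_le_ncard hs (Set.toFinite _)
  have : ({a, b, c, d} : Set V).ncard = 4 := by
    have : ({a, b, c, d} : Set V) = (({a, b, c, d} : Finset V) : Set V) := by simp
    rw [this, Set.ncard_coe_finset]
    simp [hab, hac, had, hbc, hbd, hcd]
  omega

theorem path_meet [Finite V] (hG : Subcubic G) {a b : V} (p q : G.Walk a b) (hp : p.IsPath)
    (hq : q.IsPath) (hd : WalkEdgeDisjoint p q) (i k : ℕ) (hi : i ≤ p.length) (hk : k ≤ q.length)
    (h : p.getVert i = q.getVert k) : (i = 0 ∧ k = 0) ∨ (i = p.length ∧ k = q.length) := by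
  by_cases hi0 : i = 0
  · left
    refine ⟨hi0, ?_⟩
    rw [hi0, Walk.getVert_zero] at h
    exact (hq.getVert_eq_start_iff hk).1 h.symm
  by_cases hil : i = p.length
  · right
    refine ⟨hil, ?_⟩
    rw [hil, Walk.getVert_length] at h
    exact (hq.getVert_eq_end_iff hk).1 h.symm
  have hk0 : k ≠ 0 := by
    rintro rfl
    rw [Walk.getVert_zero] at h
    exact hi0 ((hp.getVert_eq_start_iff hi).1 h)
  have hkl : k ≠ q.length := by
    rintro rfl
    rw [Walk.getVert_length] at h
    exact hil ((hp.getVert_eq_end_iff hi).1 h)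
  exfalso
  obtain ⟨i, rfl⟩ := Nat.exists_eq_succ_of_ne_zero hi0
  obtain ⟨k, rfl⟩ := Nat.exists_eq_succ_of_ne_zero hk0
  simp only [Nat.succ_eq_add_one] at *
  have p1 := p.adj_getVert_succ (i := i) (by omega)
  have p2 := p.adj_getVert_succ (i := i+1) (by omega)
  have q1 := q.adj_getVert_succ (i := k) (by omega)
  have q2 := q.adj_getVert_succ (i := k+1) (by omega)
  have ep : ∀ j < p.length, s(p.getVert j, p.getVert (j+1)) ∈ p.edges := fun j hj =>
    (Walk.mk_mem_edges_iff_exists p).2 ⟨j, hj, rfl⟩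
  have eq : ∀ j < q.length, s(q.getVert j, q.getVert (j+1)) ∈ q.edges := fun j hj =>
    (Walk.mk_mem_edges_iff_exists q).2 ⟨j, hj, rfl⟩
  have hne : ∀ {e e' : Sym2 V}, e ∈ p.edges → e' ∈ q.edges → e ≠ e' := by
    rintro e e' h1 h2 rfl; exact hd e h1 h2
  refine four_nbrs hG p1.symm p2 (h ▸ q1.symm) (h ▸ q2) ?_ ?_ ?_ ?_ ?_ ?_
  · intro h'
    have := hp.getVert_injOn (by simp; omega) (by simp; omega) h'
    omega
  · intro h'
    exact hne (ep i (by omega)) (eq k (by omega)) (by rw [h, h'])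
  · intro h'
    exact hne (ep i (by omega)) (eq (k+1) (by omega)) (by rw [h, h', Sym2.eq_swap])
  · intro h'
    exact hne (ep (i+1) (by omega)) (eq k (by omega)) (by rw [h, h', Sym2.eq_swap])
  · intro h'
    exact hne (ep (i+1) (by omega)) (eq (k+1) (by omega)) (by rw [h, h'])
  · intro h'
    have := hq.getVert_injOn (by simp; omega) (by simp; omega) h'
    omega

/-- three times the fractional point on the `i`-th edge of path `j` -/
def thetaY (j : Fin 3) (i : ℕ) : ℕ :=
  if j = 2 then (if i = 0 then 1 else 1 + (i + 1) % 2) else 1 + i % 2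

/-- the segment label of the `i`-th edge of path `j` -/
def thetaS (j : Fin 3) (i : ℕ) : ℕ := if j = 2 ∧ i = 0 then 3 else j

theorem thetaY_sum_odd (j : Fin 3) (hj : j ≠ 2) (t : ℕ) :
    ∑ i ∈ Finset.range (2 * t + 1), thetaY j i = 3 * t + 1 := by
  induction t with
  | zero => simp [thetaY, hj]
  | succ t ih =>
    rw [show 2 * (t + 1) + 1 = 2 * t + 1 + 1 + 1 by ring, Finset.sum_range_succ,
      Finset.sum_range_succ, ih]
    simp only [thetaY, hj, if_false]
    omega

theorem thetaY_sum_even (t : ℕ) :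
    ∑ i ∈ Finset.range (2 * t + 2), thetaY 2 i = 3 * t + 2 := by
  induction t with
  | zero => simp [thetaY, Finset.sum_range_succ]
  | succ t ih =>
    rw [show 2 * (t + 1) + 2 = 2 * t + 2 + 1 + 1 by ring, Finset.sum_range_succ,
      Finset.sum_range_succ, ih]
    have e1 : thetaY 2 (2 * t + 2) = 2 := by
      unfold thetaY
      rw [if_pos rfl, if_neg (by omega)]; omega
    have e2 : thetaY 2 (2 * t + 2 + 1) = 1 := by
      unfold thetaY
      rw [if_pos rfl, if_neg (by omega)]; omega
    rw [e1, e2]; ring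

theorem no_theta_aux [Fintype V] (hG : Subcubic G) (h : TPerfect G.lineGraph) {a b : V}
    (P : Fin 3 → G.Walk a b) (hP : ∀ j, (P j).IsPath)
    (hd : ∀ j k, j ≠ k → WalkEdgeDisjoint (P j) (P k))
    (t0 t1 t2 : ℕ) (h0 : (P 0).length = 2 * t0 + 1) (h1 : (P 1).length = 2 * t1 + 1)
    (h2 : (P 2).length = 2 * t2 + 2) : False := by
  let E : Fin 3 → ℕ → Sym2 V := fun j i => s((P j).getVert i, (P j).getVert (i+1))
  have hEmem : ∀ j i, i < (P j).length → E j i ∈ (P j).edges := fun j i hi =>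
    (Walk.mk_mem_edges_iff_exists _).2 ⟨i, hi, rfl⟩
  have hinj : ∀ j, ∀ i ≤ (P j).length, ∀ k ≤ (P j).length,
      (P j).getVert i = (P j).getVert k → i = k := fun j i hi k hk h' =>
    (hP j).getVert_injOn (by simpa using hi) (by simpa using hk) h'
  have hEinj : ∀ j i k l, i < (P j).length → l < (P k).length → E j i = E k l →
      j = k ∧ i = l := by
    intro j i k l hi hl he
    by_cases hjk : j = k
    · subst hjk
      refine ⟨rfl, ?_⟩
      rw [Sym2.eq_iff] at he
      rcases he with ⟨h3, -⟩ | ⟨h3, h4⟩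
      · exact hinj j _ (by omega) _ (by omega) h3
      · have := hinj j _ (by omega) _ (by omega) h3
        have := hinj j _ (by omega) _ (by omega) h4
        omega
    · exact absurd (he ▸ hEmem k l hl) (hd j k hjk _ (hEmem j i hi))
  let inH : G.edgeSet → Prop := fun e => ∃ j i, i < (P j).length ∧ (e : Sym2 V) = E j i
  obtain ⟨y, hy⟩ : ∃ y : G.edgeSet → ℕ, (∀ (e : G.edgeSet) (j : Fin 3) (i : ℕ), i < (P j).length → (e : Sym2 V) = E j i →
      y e = thetaY j i) ∧ ∀ e : G.edgeSet, ¬ inH e → y e = 0 := by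
    refine ⟨fun e => if h : inH e then thetaY h.choose h.choose_spec.choose else 0, ?_, ?_⟩
    · intro e j i hi he
      have hH : inH e := ⟨j, i, hi, he⟩
      have hs := hH.choose_spec.choose_spec
      obtain ⟨h5, h6⟩ := hEinj _ _ _ _ hs.1 hi (hs.2.symm.trans he)
      simp only [dif_pos hH]
      rw [h6, h5]
    · intro e he; simp only [dif_neg he]
  obtain ⟨g, hg⟩ : ∃ g : G.edgeSet → ℕ, (∀ (e : G.edgeSet) (j : Fin 3) (i : ℕ), i < (P j).length → (e : Sym2 V) = E j i →
      g e = thetaS j i) ∧ ∀ e : G.edgeSet, ¬ inH e → g e = 4 + (Fintype.equivFin G.edgeSet e : ℕ) := by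
    refine ⟨fun e => if h : inH e then thetaS h.choose h.choose_spec.choose else
      4 + (Fintype.equivFin G.edgeSet e : ℕ), ?_, ?_⟩
    · intro e j i hi he
      have hH : inH e := ⟨j, i, hi, he⟩
      have hs := hH.choose_spec.choose_spec
      obtain ⟨h5, h6⟩ := hEinj _ _ _ _ hs.1 hi (hs.2.symm.trans he)
      simp only [dif_pos hH]
      rw [h6, h5]
    · intro e he; simp only [dif_neg he]
  have hS3 : ∀ j i, thetaS j i ≤ 3 := by
    intro j i; unfold thetaS; split_ifs <;> omega
  have hY2 : ∀ j i, thetaY j i ≤ 2 := by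
    intro j i; unfold thetaY; split_ifs <;> omega
  have hy2 : ∀ e, y e ≤ 2 := by
    intro e
    by_cases he : inH e
    · obtain ⟨j, i, hi, he⟩ := he
      rw [hy.1 e j i hi he]; exact hY2 j i
    · rw [hy.2 e he]; omega
  have hlen : ∀ j, (j ≠ 2 → (P j).length % 2 = 1) ∧
      (j = 2 → (P j).length % 2 = 0 ∧ 2 ≤ (P j).length) := by
    intro j; fin_cases j
    · exact ⟨fun _ => by simp only [Fin.zero_eta]; omega, fun h => by simp at h⟩
    · exact ⟨fun _ => by simp only [Fin.mk_one]; omega, fun h => by simp at h⟩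
    · exact ⟨fun h => by simp at h, fun h => by
        simp only [Fin.reduceFinMk]; omega⟩
  have key : ∀ e f, G.lineGraph.Adj e f →
      (g e = g f ∧ y e + y f = 3) ∨ (g e ≠ g f ∧ y e + y f ≤ 2) := by
    intro e f hef
    by_cases he : inH e <;> by_cases hf : inH f
    · obtain ⟨j, i, hi, he⟩ := he
      obtain ⟨k, l, hl, hf⟩ := hf
      rw [hg.1 e j i hi he, hg.1 f k l hl hf, hy.1 e j i hi he, hy.1 f k l hl hf]
      rw [lineGraph_adj_iff_exists] at hef
      obtain ⟨hne, v, hve, hvf⟩ := hef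
      have hne' : ¬ (j = k ∧ i = l) := by
        rintro ⟨rfl, rfl⟩; exact hne (Subtype.ext (he.trans hf.symm))
      rw [he] at hve
      rw [hf] at hvf
      obtain ⟨p, hp, hvp⟩ : ∃ p, (p = i ∨ p = i + 1) ∧ v = (P j).getVert p := by
        rcases Sym2.mem_iff.1 hve with h | h
        · exact ⟨i, Or.inl rfl, h⟩
        · exact ⟨i+1, Or.inr rfl, h⟩
      obtain ⟨q, hq, hvq⟩ : ∃ q, (q = l ∨ q = l + 1) ∧ v = (P k).getVert q := by
        rcases Sym2.mem_iff.1 hvf with h | h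
        · exact ⟨l, Or.inl rfl, h⟩
        · exact ⟨l+1, Or.inr rfl, h⟩
      have hpq := hvp.symm.trans hvq
      by_cases hjk : j = k
      · subst hjk
        have := hinj j p (by omega) q (by omega) hpq
        have hil : l = i + 1 ∨ i = l + 1 := by
          have : i ≠ l := fun h => hne' ⟨rfl, h⟩
          omega
        unfold thetaS thetaY
        by_cases hj : j = 2
        · simp only [hj, true_and, if_true]
          have : ((2 : Fin 3) : ℕ) = 2 := rfl
          split_ifs <;> omega
        · left
          simp only [hj, false_and, if_false, true_and]
          omega
      · right
        have hm := path_meet hG (P j) (P k) (hP j) (hP k) (hd j k hjk) p q (by omega) (by omega) hpq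
        have hlj := hlen j
        have hlk := hlen k
        have hjk' : (j : ℕ) ≠ k := fun h => hjk (Fin.ext h)
        have hj2 : j = 2 ↔ (j : ℕ) = 2 := by rw [Fin.ext_iff]; rfl
        have hk2 : k = 2 ↔ (k : ℕ) = 2 := by rw [Fin.ext_iff]; rfl
        unfold thetaS thetaY
        constructor
        · split_ifs <;> omega
        · by_cases hj : j = 2
          · have a1 := hlj.2 hj
            by_cases hk : k = 2
            · exact absurd (hj.trans hk.symm) hjk
            · have a2 := hlk.1 hk
              rw [if_pos hj, if_neg hk]
              split_ifs <;> omega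
          · have a1 := hlj.1 hj
            by_cases hk : k = 2
            · have a2 := hlk.2 hk
              rw [if_neg hj, if_pos hk]
              split_ifs <;> omega
            · have a2 := hlk.1 hk
              rw [if_neg hj, if_neg hk]
              omega
    · right
      have h3 := hg.2 f hf
      have h4 := hy.2 f hf
      obtain ⟨j, i, hi, he⟩ := he
      have h5 := hS3 j i
      rw [← hg.1 e j i hi he] at h5
      have := hy2 e
      omega
    · right
      have h3 := hg.2 e he
      have h4 := hy.2 e he
      obtain ⟨j, i, hi, hf⟩ := hf
      have h5 := hS3 j i
      rw [← hg.1 f j i hi hf] at h5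
      have := hy2 f
      omega
    · right
      have hne : e ≠ f := hef.ne
      rw [hg.2 e he, hg.2 f hf, hy.2 e he, hy.2 f hf]
      refine ⟨fun h => hne ?_, by omega⟩
      exact (Fintype.equivFin G.edgeSet).injective (Fin.ext (by omega))
  let x : G.edgeSet → ℝ := fun e => (y e : ℝ) / 3
  have hxT : x ∈ TSTAB G.lineGraph := by
    refine ⟨fun e => ⟨by positivity, ?_⟩, fun e f hef => ?_, ?_⟩
    · have : (y e : ℝ) ≤ 2 := by exact_mod_cast hy2 e
      simp only [x]; linarith
    · have h3 : y e + y f ≤ 3 := by rcases key e f hef with h | h <;> omega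
      have : (y e : ℝ) + y f ≤ 3 := by exact_mod_cast h3
      simp only [x]; linarith
    · intro e c hc ho
      rw [cyc_sum c hc]
      have hs := slack_sum c.length ho (fun i => (y (c.getVert i) : ℤ))
        (fun i => (g (c.getVert i) : ℤ)) (by simp) (by simp) (by
          intro i hi
          have := key _ _ (c.adj_getVert_succ hi)
          omega)
      have h5 : ∑ i ∈ Finset.range c.length, (y (c.getVert i) : ℤ) ≤
          3 * ((c.length / 2 : ℕ) : ℤ) := by
        obtain ⟨k, hk⟩ := ho
        omega
      have h6 : ∑ i ∈ Finset.range c.length, (y (c.getVert i) : ℝ) ≤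
          3 * ((c.length / 2 : ℕ) : ℝ) := by exact_mod_cast h5
      simp only [x, ← Finset.sum_div]
      linarith
  have hxS : x ∈ stableSetPolytope G.lineGraph := by
    rw [show stableSetPolytope G.lineGraph = _ from h]; exact hxT
  let EH : Finset G.edgeSet := Finset.univ.filter inH
  let VH : Finset V := (Finset.range (2 * t0 + 2)).image (P 0).getVert ∪
    ((Finset.Ico 1 (2 * t1 + 1)).image (P 1).getVert ∪
      (Finset.Ico 1 (2 * t2 + 2)).image (P 2).getVert)
  have hVH : VH.card ≤ 2 * (t0 + t1 + t2) + 3 := by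
    have c0 := Finset.card_image_le (s := Finset.range (2 * t0 + 2)) (f := (P 0).getVert)
    have c1 := Finset.card_image_le (s := Finset.Ico 1 (2 * t1 + 1)) (f := (P 1).getVert)
    have c2 := Finset.card_image_le (s := Finset.Ico 1 (2 * t2 + 2)) (f := (P 2).getVert)
    have u1 := Finset.card_union_le ((Finset.range (2 * t0 + 2)).image (P 0).getVert)
      ((Finset.Ico 1 (2 * t1 + 1)).image (P 1).getVert ∪
      (Finset.Ico 1 (2 * t2 + 2)).image (P 2).getVert)
    have u2 := Finset.card_union_le ((Finset.Ico 1 (2 * t1 + 1)).image (P 1).getVert)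
      ((Finset.Ico 1 (2 * t2 + 2)).image (P 2).getVert)
    simp only [Finset.card_range, Nat.card_Ico] at c0 c1 c2
    show (_ ∪ (_ ∪ _) : Finset V).card ≤ _
    omega
  have hVmem : ∀ j i, i ≤ (P j).length → (P j).getVert i ∈ VH := by
    intro j i hi
    simp only [VH, Finset.mem_union, Finset.mem_image, Finset.mem_range, Finset.mem_Ico]
    by_cases hi0 : i = 0
    · left; exact ⟨0, by omega, by simp [hi0]⟩
    by_cases hil : i = (P j).length
    · left; exact ⟨(P 0).length, by omega, by simp [hil]⟩
    fin_cases j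
    · left; exact ⟨i, by simp at *; omega, rfl⟩
    · right; left; exact ⟨i, by simp at *; omega, rfl⟩
    · right; right; exact ⟨i, by simp at *; omega, rfl⟩
  have hst := stab_le (H := G.lineGraph) (fun e => if e ∈ EH then 1 else 0)
    ((t0 + t1 + t2 + 1 : ℕ) : ℝ) (by
    intro s hs
    have : ∑ e, (if e ∈ EH then (1:ℝ) else 0) * (s.indicator 1 e : ℝ)
        = ((EH.filter (· ∈ s)).card : ℝ) := by
      rw [Finset.card_filter]
      push_cast
      simp only [ite_mul, one_mul, zero_mul, Finset.sum_ite_mem, Finset.univ_inter]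
      apply Finset.sum_congr rfl
      intro e _
      simp [Set.indicator_apply]
    rw [this]
    have hb : ((EH.filter (· ∈ s)).biUnion (fun e => (e : Sym2 V).toFinset)).card =
        ∑ e ∈ EH.filter (· ∈ s), 2 := by
      rw [Finset.card_biUnion]
      · apply Finset.sum_congr rfl
        intro e he
        exact Sym2.card_toFinset_of_not_isDiag _ (G.not_isDiag_of_mem_edgeSet e.2)
      · intro e he f hf hef
        simp only [Function.onFun]
        rw [Finset.disjoint_left]
        intro v hv hv'
        simp only [Sym2.mem_toFinset, Finset.coe_filter, Set.mem_ofPred_eq] at hv hv' he hf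
        have he2 : e ∈ s := he.2
        have hf2 : f ∈ s := hf.2
        exact hs he2 hf2 hef (lineGraph_adj_iff_exists.2 ⟨hef, v, hv, hv'⟩)
    have hsub : (EH.filter (· ∈ s)).biUnion (fun e => (e : Sym2 V).toFinset) ⊆ VH := by
      intro v hv
      simp only [Finset.mem_biUnion, Finset.mem_filter, Sym2.mem_toFinset, EH,
        Finset.mem_univ, true_and] at hv
      obtain ⟨e, ⟨⟨j, i, hi, he⟩, -⟩, hv⟩ := hv
      rw [he] at hv
      rcases Sym2.mem_iff.1 hv with rfl | rfl
      · exact hVmem j i (by omega)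
      · exact hVmem j (i+1) (by omega)
    have hcard := Finset.card_le_card hsub
    rw [hb] at hcard
    simp only [Finset.sum_const, smul_eq_mul] at hcard
    have : (EH.filter (· ∈ s)).card ≤ t0 + t1 + t2 + 1 := by omega
    exact_mod_cast this) x hxS
  have htot : ∑ e ∈ EH, y e = 3 * (t0 + t1 + t2) + 4 := by
    have hb : ∑ p ∈ (Finset.univ : Finset (Fin 3)).sigma (fun j => Finset.range (P j).length),
        thetaY p.1 p.2 = ∑ e ∈ EH, y e := by
      refine Finset.sum_bij (fun p hp => ⟨E p.1 p.2, (P p.1).edges_subset_edgeSet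
        (hEmem p.1 p.2 (by simpa using hp))⟩) ?_ ?_ ?_ ?_
      · intro p hp
        simp only [EH, Finset.mem_filter, Finset.mem_univ, true_and]
        exact ⟨p.1, p.2, by simpa using hp, rfl⟩
      · intro p hp q hq hpq
        obtain ⟨h5, h6⟩ := hEinj p.1 p.2 q.1 q.2 (by simpa using hp) (by simpa using hq)
          (congrArg Subtype.val hpq)
        rcases p with ⟨p1, p2⟩
        rcases q with ⟨q1, q2⟩
        simp only at h5 h6
        subst h5 h6
        rfl
      · intro e he
        simp only [EH, Finset.mem_filter, Finset.mem_univ, true_and] at he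
        obtain ⟨j, i, hi, he⟩ := he
        exact ⟨⟨j, i⟩, by simpa using hi, Subtype.ext he.symm⟩
      · intro p hp
        exact (hy.1 _ p.1 p.2 (by simpa using hp) rfl).symm
    rw [← hb, Finset.sum_sigma, Fin.sum_univ_three, h0, h1, h2, thetaY_sum_odd 0 (by decide),
      thetaY_sum_odd 1 (by decide), thetaY_sum_even]
    ring
  have hfin : ∑ e, (if e ∈ EH then (1:ℝ) else 0) * x e = (∑ e ∈ EH, y e : ℕ) / 3 := by
    push_cast
    rw [Finset.sum_div]
    simp only [ite_mul, one_mul, zero_mul, Finset.sum_ite_mem, Finset.univ_inter, x]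
  rw [hfin, htot] at hst
  push_cast at hst
  linarith

theorem no_theta_of_tperfect [Fintype V] (hG : Subcubic G) (h : TPerfect G.lineGraph) :
    ¬ HasSkewedTheta G := by
  rintro ⟨a, b, p₁, p₂, p₃, h1, h2, h3, d12, d13, d23, ⟨t0, o1⟩, ⟨t1, o2⟩, ev⟩
  have hab : a ≠ b := by
    rintro rfl
    have := Walk.isPath_iff_nil.1 h1
    rw [← Walk.length_eq_zero_iff] at this
    omega
  have h3l : p₃.length ≠ 0 := fun h => hab (Walk.eq_of_length_eq_zero h)
  have hsymm : ∀ {p q : G.Walk a b}, WalkEdgeDisjoint p q → WalkEdgeDisjoint q p :=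
    fun hpq e h1 h2 => hpq e h2 h1
  obtain ⟨t2, ht2⟩ : ∃ t2, p₃.length = 2 * t2 + 2 := by
    obtain ⟨k, hk⟩ := ev
    exact ⟨k - 1, by omega⟩
  refine no_theta_aux hG h ![p₁, p₂, p₃] ?_ ?_ t0 t1 t2 o1 o2 ht2
  · intro j; fin_cases j
    · exact h1
    · exact h2
    · exact h3
  · intro j k hjk
    fin_cases j <;> fin_cases k <;> first | exact absurd rfl hjk | skip
    · exact d12
    · exact d13
    · exact hsymm d12
    · exact d23
    · exact hsymm d13
    · exact hsymm d23

end Theta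


section Poly

theorem poly_le {ι : Type*} [Fintype ι] (S : Finset (ι → ℝ)) (P : Set (ι → ℝ))
    (h : ∀ w : ι → ℝ, w ≠ 0 → ∃ (a : ι → ℝ) (β : ℝ), (∀ y ∈ P, a ⬝ᵥ y ≤ β) ∧
      (∀ s ∈ S, a ⬝ᵥ s ≤ β) ∧ (∀ s ∈ S, (∀ t ∈ S, w ⬝ᵥ t ≤ w ⬝ᵥ s) → a ⬝ᵥ s = β) ∧
      ∃ s ∈ S, a ⬝ᵥ s < β) (x : ι → ℝ) (hx : x ∈ P) (N : ℕ) :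
    ∀ (w : ι → ℝ) (ν : ℝ), (∃ s ∈ S, w ⬝ᵥ s = ν) → (∀ s ∈ S, w ⬝ᵥ s ≤ ν) →
      (S.filter (fun s => w ⬝ᵥ s < ν)).card ≤ N → w ⬝ᵥ x ≤ ν := by
  induction N with
  | zero =>
    intro w ν ⟨s0, hs0, hs0'⟩ hle hc
    by_cases hw : w = 0
    · subst hw; simp at hs0' ⊢; exact hs0'.le
    exfalso
    obtain ⟨a, β, h1, h2, h3, s, hs, hs'⟩ := h w hw
    have : ∀ t ∈ S, ν ≤ w ⬝ᵥ t := by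
      intro t ht
      by_contra hlt
      have : t ∈ (S.filter (fun s => w ⬝ᵥ s < ν)) := by simp [ht]; linarith
      rw [Nat.le_zero, Finset.card_eq_zero] at hc
      rw [hc] at this; simp at this
    have := h3 s hs (fun t ht => (hle t ht).trans (this s hs))
    linarith
  | succ N ih =>
    intro w ν ⟨s0, hs0, hs0'⟩ hle hc
    by_cases hw : w = 0
    · subst hw; simp at hs0' ⊢; exact hs0'.le
    obtain ⟨a, β, h1, h2, h3, s, hs, hs'⟩ := h w hw
    have hT : (S.filter (fun s => a ⬝ᵥ s < β)).Nonempty := ⟨s, by simp [hs, hs']⟩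
    obtain ⟨r, hr, hmin⟩ := Finset.exists_min_image _ (fun s => (ν - w ⬝ᵥ s) / (β - a ⬝ᵥ s)) hT
    simp only [Finset.mem_filter] at hr hmin
    set ε := (ν - w ⬝ᵥ r) / (β - a ⬝ᵥ r) with hε
    have hrν : w ⬝ᵥ r < ν := by
      rcases (hle r hr.1).lt_or_eq with h' | h'
      · exact h'
      · have := h3 r hr.1 (fun t ht => (hle t ht).trans h'.ge)
        linarith [hr.2]
    have hε0 : 0 < ε := div_pos (by linarith) (by linarith [hr.2])
    have hεr : ε * (β - a ⬝ᵥ r) = ν - w ⬝ᵥ r := by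
      rw [hε]; field_simp [show β - a ⬝ᵥ r ≠ 0 by linarith [hr.2]]
    have hd : ∀ y, (w - ε • a) ⬝ᵥ y = w ⬝ᵥ y - ε * (a ⬝ᵥ y) := by
      intro y; rw [sub_dotProduct, smul_dotProduct, smul_eq_mul]
    have hs0a := h3 s0 hs0 (fun t ht => (hle t ht).trans hs0'.ge)
    have hle' : ∀ t ∈ S, (w - ε • a) ⬝ᵥ t ≤ ν - ε * β := by
      intro t ht
      rw [hd]
      rcases (h2 t ht).lt_or_eq with h' | h'
      · have h4 := hmin t ⟨ht, h'⟩
        rw [le_div_iff₀ (by linarith)] at h4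
        linarith
      · rw [h']; linarith [hle t ht]
    have hfin := ih (w - ε • a) (ν - ε * β) ⟨s0, hs0, by rw [hd, hs0', hs0a]⟩ hle' ?_
    · rw [hd] at hfin
      have := mul_le_mul_of_nonneg_left (h1 x hx) hε0.le
      linarith
    · have hss : (S.filter (fun s => (w - ε • a) ⬝ᵥ s < ν - ε * β)) ⊂
          (S.filter (fun s => w ⬝ᵥ s < ν)) := by
        rw [Finset.ssubset_iff_of_subset]
        · refine ⟨r, by simp [hr.1, hrν], ?_⟩
          simp only [Finset.mem_filter, not_and, not_lt]
          intro _
          rw [hd]; linarith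
        · intro t ht
          simp only [Finset.mem_filter] at ht ⊢
          refine ⟨ht.1, lt_of_le_of_ne (hle t ht.1) ?_⟩
          intro heq
          have := h3 t ht.1 (fun t' ht' => (hle t' ht').trans heq.ge)
          have h6 := ht.2
          rw [hd, this, heq] at h6
          linarith
      have := Finset.card_lt_card hss
      omega

theorem poly_sub {ι : Type*} [Fintype ι] (S : Finset (ι → ℝ)) (hS : S.Nonempty) (P : Set (ι → ℝ))
    (h : ∀ w : ι → ℝ, w ≠ 0 → ∃ (a : ι → ℝ) (β : ℝ), (∀ y ∈ P, a ⬝ᵥ y ≤ β) ∧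
      (∀ s ∈ S, a ⬝ᵥ s ≤ β) ∧ (∀ s ∈ S, (∀ t ∈ S, w ⬝ᵥ t ≤ w ⬝ᵥ s) → a ⬝ᵥ s = β) ∧
      ∃ s ∈ S, a ⬝ᵥ s < β) : P ⊆ convexHull ℝ (S : Set (ι → ℝ)) := by
  intro x hx
  by_contra hcon
  obtain ⟨f, u, hf1, hf2⟩ := geometric_hahn_banach_closed_point (convex_convexHull ℝ _)
    (S.finite_toSet.isCompact_convexHull ℝ).isClosed hcon
  let w : ι → ℝ := fun i => f (Pi.single i 1)
  have hfw : ∀ y, f y = w ⬝ᵥ y := by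
    intro y
    conv_lhs => rw [pi_eq_sum_univ' y]
    rw [map_sum]
    simp only [dotProduct, w, map_smul, smul_eq_mul]
    apply Finset.sum_congr rfl
    intro i _
    rw [mul_comm]
  obtain ⟨r, hr, hmax⟩ := Finset.exists_max_image S (fun s => w ⬝ᵥ s) hS
  have h1 := poly_le S P h x hx _ w (w ⬝ᵥ r) ⟨r, hr, rfl⟩ hmax le_rfl
  have h2 := hf1 r (subset_convexHull ℝ _ hr)
  rw [hfw] at h2 hf2
  linarith

end Poly


section Gallai

set_option linter.unusedSectionVars false

variable {V : Type u} [Fintype V] {F : SimpleGraph V} {ω : Sym2 V → ℝ}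

/-- matchings of `F` as involutions -/
def IsMat (F : SimpleGraph V) (m : V → V) : Prop :=
  (∀ v, m (m v) = v) ∧ ∀ v, m v ≠ v → F.Adj v (m v)

/-- twice the weight of a matching -/
noncomputable def matW (ω : Sym2 V → ℝ) (m : V → V) : ℝ := ∑ v, ω s(v, m v)

/-- maximum weight matchings -/
def IsMaxMat (F : SimpleGraph V) (ω : Sym2 V → ℝ) (m : V → V) : Prop :=
  IsMat F m ∧ ∀ n, IsMat F n → matW ω n ≤ matW ω m

theorem isMat_swap {m n : V → V} (hm : IsMat F m) (hn : IsMat F n) (T : V → Prop)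
    (hTm : ∀ v, T v → T (m v)) (hTn : ∀ v, T v → T (n v)) :
    IsMat F (fun v => if T v then n v else m v) := by
  constructor
  · intro v
    by_cases h : T v
    · simp only [h, if_true, hTn v h, hn.1]
    · have : ¬ T (m v) := fun h' => h (by have := hTm _ h'; rwa [hm.1] at this)
      simp only [h, if_false, this, hm.1]
  · intro v hv
    by_cases h : T v
    · simp only [h, if_true] at hv ⊢; exact hn.2 v hv
    · simp only [h, if_false] at hv ⊢; exact hm.2 v hv

theorem isMax_swap {m n : V → V} (hm : IsMaxMat F ω m) (hn : IsMaxMat F ω n) (T : V → Prop)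
    (hTm : ∀ v, T v → T (m v)) (hTn : ∀ v, T v → T (n v)) :
    IsMaxMat F ω (fun v => if T v then n v else m v) := by
  refine ⟨isMat_swap hm.1 hn.1 T hTm hTn, fun k hk => ?_⟩
  have h1 := hm.2 _ (isMat_swap hn.1 hm.1 T hTn hTm)
  have h2 := hn.2 k hk
  have h3 : matW ω (fun v => if T v then n v else m v) +
      matW ω (fun v => if T v then m v else n v) = matW ω m + matW ω n := by
    simp only [matW, ← Finset.sum_add_distrib]
    apply Finset.sum_congr rfl
    intro v _
    split_ifs
    · ring
    · ring
  linarith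

theorem not_both_missed (hd : ∀ v, ω s(v, v) = 0) (hF : ∀ u v, F.Adj u v → 0 < ω s(u, v))
    {m : V → V} (hm : IsMaxMat F ω m) {u v : V} (huv : F.Adj u v) (hu : m u = u) : m v ≠ v := by
  intro hv
  have hne : u ≠ v := huv.ne
  let m' : V → V := fun x => if x = u then v else if x = v then u else m x
  have hm' : IsMat F m' := by
    constructor
    · intro x
      simp only [m']
      by_cases h1 : x = u
      · subst h1; simp [hne.symm]
      · by_cases h2 : x = v
        · subst h2; simp [h1]
        · have h3 : m x ≠ u := fun h => h1 (by rw [← hm.1.1 x, h, hu])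
          have h4 : m x ≠ v := fun h => h2 (by rw [← hm.1.1 x, h, hv])
          simp [h1, h2, h3, h4, hm.1.1]
    · intro x hx
      simp only [m'] at hx ⊢
      by_cases h1 : x = u
      · subst h1; simpa using huv
      · by_cases h2 : x = v
        · subst h2; simpa [h1] using huv.symm
        · simp only [h1, h2, if_false] at hx ⊢
          exact hm.1.2 x hx
  have h1 := hm.2 m' hm'
  have h2 : matW ω m < matW ω m' := by
    apply Finset.sum_lt_sum
    · intro x _
      simp only [m']
      by_cases hxu : x = u
      · subst hxu; simp only [if_true, hu, hd]; exact (hF _ _ huv).le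
      · by_cases h2 : x = v
        · subst h2; rw [if_neg hxu, if_pos rfl, hv, hd]; exact (hF _ _ huv.symm).le
        · simp [hxu, h2]
    · refine ⟨u, Finset.mem_univ _, ?_⟩
      simp only [m', if_true, hu, hd]
      exact hF _ _ huv
  linarith

/-- the alternating permutation -/
def altP {m n : V → V} (hm : IsMat F m) (hn : IsMat F n) : Equiv.Perm V :=
  Function.Involutive.toPerm n hn.1 * Function.Involutive.toPerm m hm.1

theorem altP_n {m n : V → V} (hm : IsMat F m) (hn : IsMat F n) {t : V} (ht : n t = t) (k : ℤ) :
    n ((altP hm hn ^ k) t) = (altP hm hn ^ (-k)) t := by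
  set a := Function.Involutive.toPerm n hn.1 with ha
  set b := Function.Involutive.toPerm m hm.1 with hb
  have ha2 : a * a = 1 := by ext x; exact hn.1 x
  have hb2 : b * b = 1 := by ext x; exact hm.1 x
  have hai : a⁻¹ = a := inv_eq_of_mul_eq_one_left ha2
  have hbi : b⁻¹ = b := inv_eq_of_mul_eq_one_left hb2
  have h1 : a * altP hm hn * a⁻¹ = (altP hm hn)⁻¹ := by
    show a * (a * b) * a⁻¹ = (a * b)⁻¹
    rw [mul_inv_rev, hai, hbi, ← mul_assoc, ha2, one_mul]
  have h2 : a * altP hm hn ^ k * a⁻¹ = (altP hm hn) ^ (-k) := by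
    rw [← conj_zpow, h1, inv_zpow, zpow_neg]
  rw [← h2]
  show a _ = (a * altP hm hn ^ k * a⁻¹) t
  rw [hai, Equiv.Perm.mul_apply, Equiv.Perm.mul_apply]
  have : a t = t := ht
  rw [this]

theorem altP_m {m n : V → V} (hm : IsMat F m) (hn : IsMat F n) {t : V} (ht : n t = t) (k : ℤ) :
    m ((altP hm hn ^ k) t) = (altP hm hn ^ (-k - 1)) t := by
  have h1 : (altP hm hn ^ (k+1)) t = n (m ((altP hm hn ^ k) t)) := by
    rw [add_comm, zpow_add, zpow_one]; rfl
  have h2 := altP_n hm hn ht (k+1)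
  rw [h1, hn.1] at h2
  rw [h2]; congr 2; ring

theorem zpow_apply_eq_iff (σ : Equiv.Perm V) (t : V) (i j : ℤ) :
    (σ ^ i) t = (σ ^ j) t ↔ ((Function.minimalPeriod σ t : ℕ) : ℤ) ∣ i - j := by
  have h := MulAction.zpow_smul_eq_iff_minimalPeriod_dvd (a := σ) (b := t) (n := i - j)
  have h2 : (σ ^ (i - j)) • t = t ↔ (σ ^ i) t = (σ ^ j) t := by
    show (σ ^ (i - j)) t = t ↔ _
    rw [sub_eq_neg_add, zpow_add, Equiv.Perm.mul_apply, zpow_neg, Equiv.Perm.inv_eq_iff_eq, eq_comm]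
  rw [← h2, h]
  rfl

theorem minPer_pos (σ : Equiv.Perm V) (t : V) : 0 < Function.minimalPeriod σ t :=
  Function.minimalPeriod_pos_of_mem_periodicPts (σ.injective.mem_periodicPts t)

theorem gallai_swap {m n : V → V} (hm : IsMaxMat F ω m) (hn : IsMaxMat F ω n) {u v t : V}
    (huv : u ≠ v) (hu : m u = u) (hv : m v = v) (ht : n t = t) :
    (∃ m', IsMaxMat F ω m' ∧ m' t = t ∧ m' u = u) ∨ (∃ m', IsMaxMat F ω m' ∧ m' t = t ∧ m' v = v) := by
  set σ := altP hm.1 hn.1 with hσ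
  let T : V → Prop := fun x => ∃ k : ℤ, (σ ^ k) t = x
  have hTm : ∀ x, T x → T (m x) := by
    rintro x ⟨k, rfl⟩
    exact ⟨-k-1, (altP_m hm.1 hn.1 ht k).symm⟩
  have hTn : ∀ x, T x → T (n x) := by
    rintro x ⟨k, rfl⟩
    exact ⟨-k, (altP_n hm.1 hn.1 ht k).symm⟩
  have hmax := isMax_swap hm hn T hTm hTn
  have hT : T t := ⟨0, by simp⟩
  by_cases hTu : T u
  · by_cases hTv : T v
    · exfalso
      obtain ⟨i, rfl⟩ := hTu
      obtain ⟨j, rfl⟩ := hTv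
      rw [altP_m hm.1 hn.1 ht, zpow_apply_eq_iff] at hu hv
      apply huv
      rw [zpow_apply_eq_iff]
      obtain ⟨p, hp⟩ := hu
      obtain ⟨q, hq⟩ := hv
      refine ⟨p * (2 * j + 1) * (j - i) * 0 + (-(i - j) * p - i * (q - p)), ?_⟩
      have : (Function.minimalPeriod σ t : ℤ) * (-(i - j) * p - i * (q - p)) =
        -(i-j) * (Function.minimalPeriod σ t * p) - i * (Function.minimalPeriod σ t * q -
          Function.minimalPeriod σ t * p) := by ring
      simp only [mul_zero, zero_add]
      rw [this, ← hp, ← hq]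
      ring
    · right
      exact ⟨_, hmax, by simp [hT, ht], by simp [hTv, hv]⟩
  · left
    exact ⟨_, hmax, by simp [hT, ht], by simp [hTu, hu]⟩

/-- Gallai's relation -/
def Sim (F : SimpleGraph V) (ω : Sym2 V → ℝ) (u v : V) : Prop :=
  u = v ∨ ∀ m, IsMaxMat F ω m → ¬ (m u = u ∧ m v = v)

theorem sim_trans {n : V → V} {u t v : V} (hn : IsMaxMat F ω n) (ht : n t = t)
    (h1 : Sim F ω u t) (h2 : Sim F ω t v) : Sim F ω u v := by
  rcases h1 with rfl | h1
  · exact h2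
  rcases h2 with rfl | h2
  · exact Or.inr h1
  by_cases huv : u = v
  · exact Or.inl huv
  right
  rintro m hm ⟨hu, hv⟩
  rcases gallai_swap hm hn huv hu hv ht with ⟨m', hm', h3, h4⟩ | ⟨m', hm', h3, h4⟩
  · exact h1 m' hm' ⟨h4, h3⟩
  · exact h2 m' hm' ⟨h3, h4⟩

theorem sim_of_reachable (hd : ∀ v, ω s(v, v) = 0) (hF : ∀ u v, F.Adj u v → 0 < ω s(u, v))
    {u v : V} (p : F.Walk u v) (hK : ∀ v, F.Reachable u v → ∃ m, IsMaxMat F ω m ∧ m v = v) :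
    Sim F ω u v := by
  induction p with
  | nil => exact Or.inl rfl
  | @cons a b c hab p ih =>
    obtain ⟨n, hn, hb⟩ := hK b hab.reachable
    refine sim_trans hn hb (Or.inr ?_) (ih fun v hv => hK v (hab.reachable.trans hv))
    rintro m hm ⟨h1, h2⟩
    exact not_both_missed hd hF hm hab h1 h2

theorem reach_mat {m : V → V} (hm : IsMat F m) (v : V) : F.Reachable v (m v) := by
  by_cases h : m v = v
  · rw [h]
  · exact (hm.2 v h).reachable

/-- exponent of the `i`-th vertex of the alternating path -/
def zExp (i : ℕ) : ℤ := if i % 2 = 0 then (i / 2 : ℕ) else -((i / 2 : ℕ) : ℤ) - 1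

theorem alt_path {m n : V → V} (hm : IsMat F m) (hn : IsMat F n) {u v : V}
    (hu : n u = u) (hnu : ∀ x, F.Reachable u x → n x = x → x = u)
    (hmv : ∀ x, F.Reachable u x → m x = x → x = v) :
    ∃ (h : ℕ) (y : ℕ → V), y 0 = u ∧ y (2 * h) = v ∧
      (∀ i ≤ 2 * h, ∀ j ≤ 2 * h, y i = y j → i = j) ∧
      (∀ i < 2 * h, F.Adj (y i) (y (i + 1))) ∧
      (∀ i < 2 * h, i % 2 = 0 → y (i + 1) = m (y i)) ∧
      (∀ i ≤ 2 * h, ∃ j ≤ 2 * h, m (y i) = y j) ∧ m v = v := by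
  set σ := altP hm hn with hσ
  set L := Function.minimalPeriod σ u with hL
  have hL0 : 0 < L := minPer_pos σ u
  have hreach : ∀ k : ℕ, F.Reachable u ((σ ^ (k : ℤ)) u) := by
    intro k
    induction k with
    | zero => simp
    | succ k ih =>
      have : (σ ^ ((k + 1 : ℕ) : ℤ)) u = n (m ((σ ^ (k : ℤ)) u)) := by
        push_cast
        rw [add_comm, zpow_add, zpow_one]; rfl
      rw [this]
      exact (ih.trans (reach_mat hm _)).trans (reach_mat hn _)
  have hodd : L % 2 = 1 := by
    by_contra hne
    obtain ⟨l, hl⟩ : ∃ l, L = 2 * l := ⟨L / 2, by omega⟩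
    have h1 := hnu _ (hreach l) (by
      rw [altP_n hm hn hu, zpow_apply_eq_iff]
      refine ⟨-1, ?_⟩
      rw [← hσ, ← hL, hl]; push_cast; ring)
    have h2 := (zpow_apply_eq_iff σ u l 0).1 (by simpa using h1)
    rw [← hL, sub_zero] at h2
    have := Int.le_of_dvd (by omega) h2
    omega
  obtain ⟨h, hh⟩ : ∃ h, L = 2 * h + 1 := ⟨L / 2, by omega⟩
  have hfix : m ((σ ^ (h : ℤ)) u) = (σ ^ (h : ℤ)) u := by
    rw [altP_m hm hn hu, zpow_apply_eq_iff]
    refine ⟨-1, ?_⟩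
    rw [← hσ, ← hL, hh]; push_cast; ring
  have hv : (σ ^ (h : ℤ)) u = v := hmv _ (hreach h) hfix
  have hz : ∀ i ≤ 2 * h, -(h : ℤ) ≤ zExp i ∧ zExp i ≤ h := by
    intro i hi; unfold zExp; split_ifs <;> omega
  have hinj : ∀ i ≤ 2 * h, ∀ j ≤ 2 * h, (σ ^ zExp i) u = (σ ^ zExp j) u → i = j := by
    intro i hi j hj hij
    rw [zpow_apply_eq_iff, ← hL] at hij
    have h1 := hz i hi
    have h2 := hz j hj
    have h3 := Int.eq_zero_of_abs_lt_dvd hij (by rw [abs_lt]; omega)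
    unfold zExp at h3
    split_ifs at h3 <;> omega
  have hz2 : zExp (2 * h) = h := by unfold zExp; split_ifs <;> omega
  have hsm : ∀ i, i % 2 = 0 → (σ ^ zExp (i + 1)) u = m ((σ ^ zExp i) u) := by
    intro i hi
    rw [altP_m hm hn hu]
    congr 2
    unfold zExp; split_ifs <;> omega
  have hsn : ∀ i, i % 2 = 1 → (σ ^ zExp (i + 1)) u = n ((σ ^ zExp i) u) := by
    intro i hi
    rw [altP_n hm hn hu]
    congr 2
    unfold zExp; split_ifs <;> omega
  refine ⟨h, fun i => (σ ^ zExp i) u, by simp [zExp], by simp only [hz2, hv], hinj, ?_,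
    fun i _ hi => hsm i hi, ?_, hv ▸ hfix⟩
  · intro i hi
    have hne : (σ ^ zExp (i+1)) u ≠ (σ ^ zExp i) u := fun h' => by
      have := hinj _ (by omega) _ (by omega) h'
      omega
    show F.Adj ((σ ^ zExp i) u) ((σ ^ zExp (i + 1)) u)
    rcases Nat.mod_two_eq_zero_or_one i with h0 | h0
    · rw [hsm i h0] at hne ⊢; exact hm.2 _ hne
    · rw [hsn i h0] at hne ⊢; exact hn.2 _ hne
  · intro i hi
    rcases Nat.mod_two_eq_zero_or_one i with h0 | h0
    · by_cases hi2 : i = 2 * h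
      · exact ⟨2 * h, le_rfl, by simp only [hi2, hz2, hfix]⟩
      · exact ⟨i + 1, by omega, (hsm i h0).symm⟩
    · refine ⟨i - 1, by omega, ?_⟩
      have := hsm (i - 1) (by omega)
      rw [Nat.sub_add_cancel (by omega)] at this
      show m ((σ ^ zExp i) u) = (σ ^ zExp (i - 1)) u
      rw [this, hm.1]

end Gallai


section Core

variable {V : Type u} {G : SimpleGraph V}

theorem theta_of_ear {x p z : V} (c : G.Walk x x) (hc : c.IsCycle) (ho : Odd c.length)
    (hp : p ∈ c.support) (hz : z ∈ c.support) (hpz : p ≠ z) (e : G.Walk p z) (he : e.IsPath)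
    (heo : Odd e.length) (hd : ∀ a, a ∈ e.edges → a ∉ c.edges) : HasSkewedTheta G := by
  set c' := c.rotate p hp with hc'
  have hcyc : c'.IsCycle := (Walk.isCycle_rotate hp).2 hc
  have hz' : z ∈ c'.support := (Walk.mem_support_rotate_iff c p hp).2 hz
  have hed : ∀ a, a ∈ c'.edges ↔ a ∈ c.edges := fun a => (c.rotate_edges p hp).mem_iff
  have hlen : c'.length = c.length := Walk.length_rotate c p hp
  set q1 := c'.takeUntil z hz' with hq1
  set q2 := c'.dropUntil z hz' with hq2
  have hsp : q1.append q2 = c' := c'.take_spec hz'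
  have h1 : q1.IsPath := hcyc.isPath_takeUntil hz'
  have h2 : q2.IsPath := by
    refine Walk.IsCycle.isPath_of_append_right (p := q1) ?_ (hsp ▸ hcyc)
    intro hn
    exact hpz hn.eq
  have hdis : q1.edges.Disjoint q2.edges := hcyc.isTrail.disjoint_edges_takeUntil_dropUntil hz'
  have hs1 : ∀ a ∈ q1.edges, a ∈ c.edges := fun a ha =>
    (hed a).1 (c'.edges_takeUntil_subset_edges hz' ha)
  have hs2 : ∀ a ∈ q2.edges, a ∈ c.edges := fun a ha =>
    (hed a).1 (c'.edges_dropUntil_subset_edges hz' ha)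
  have hl : q1.length + q2.length = c.length := by
    rw [← hlen, ← hsp, Walk.length_append]
  have d1 : WalkEdgeDisjoint e q1 := fun a h3 h4 => hd a h3 (hs1 a h4)
  have d2 : WalkEdgeDisjoint e q2.reverse := fun a h3 h4 =>
    hd a h3 (hs2 a (by simpa using h4))
  have d3 : WalkEdgeDisjoint q1 q2.reverse := fun a h3 h4 => hdis h3 (by simpa using h4)
  have d4 : WalkEdgeDisjoint q2.reverse q1 := fun a h3 h4 => d3 a h4 h3
  rw [← hl] at ho
  rcases Nat.even_or_odd q1.length with h5 | h5
  · refine ⟨p, z, e, q2.reverse, q1, he, h2.reverse, h1, d2, d1, d4, heo, ?_, h5⟩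
    rw [Walk.length_reverse]
    rw [Nat.odd_iff] at *; rw [Nat.even_iff] at *; omega
  · refine ⟨p, z, e, q1, q2.reverse, he, h1, h2.reverse, d1, d2, d3, heo, h5, ?_⟩
    rw [Walk.length_reverse]
    rw [Nat.odd_iff] at *; rw [Nat.even_iff] at *; omega

theorem cyc_deg [Finite V] (hG : Subcubic G) {x p q r : V} (c : G.Walk x x) (hc : c.IsCycle)
    (hp : p ∈ c.support) (hq : G.Adj p q) (hr : G.Adj p r) (hqr : q ≠ r)
    (hqc : q ∉ c.support) (hrc : r ∉ c.support) : False := by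
  set c' := c.rotate p hp with hc'
  have hcyc : c'.IsCycle := (Walk.isCycle_rotate hp).2 hc
  have hs : ∀ a, a ∈ c'.support ↔ a ∈ c.support := fun a => Walk.mem_support_rotate_iff c p hp
  have m1 : c'.snd ∈ c.support := (hs _).1 (c'.getVert_mem_support 1)
  have m2 : c'.penultimate ∈ c.support := (hs _).1 (c'.getVert_mem_support _)
  refine four_nbrs hG (c'.adj_snd hcyc.not_nil) (c'.adj_penultimate hcyc.not_nil).symm hq hr
    hcyc.snd_ne_penultimate ?_ ?_ ?_ ?_ hqr
  · rintro h; exact hqc (h ▸ m1)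
  · rintro h; exact hrc (h ▸ m1)
  · rintro h; exact hqc (h ▸ m2)
  · rintro h; exact hrc (h ▸ m2)

variable [Fintype V] {F : SimpleGraph V} {ω : Sym2 V → ℝ}

theorem ear_closed (hG : Subcubic G) (hT : ¬ HasSkewedTheta G) (hFG : F ≤ G) {x : V}
    (c : G.Walk x x) (hc : c.IsCycle) (ho : Odd c.length) {m : V → V} (hm : IsMat F m)
    (hmc : ∀ a ∈ c.support, m a ∈ c.support)
    (hear : ∀ q, (∃ p ∈ c.support, F.Adj p q) → ∃ (h : ℕ) (y : ℕ → V), y 0 = q ∧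
      y (2 * h) ∈ c.support ∧
      (∀ i ≤ 2 * h, ∀ j ≤ 2 * h, y i = y j → i = j) ∧
      (∀ i < 2 * h, F.Adj (y i) (y (i + 1))) ∧
      (∀ i < 2 * h, i % 2 = 0 → y (i + 1) = m (y i)))
    {p q : V} (hp : p ∈ c.support) (hpq : F.Adj p q) : s(p, q) ∈ c.edges := by
  by_contra hne
  by_cases hq : q ∈ c.support
  · refine hT (theta_of_ear c hc ho hp hq hpq.ne (hFG hpq).toWalk ?_ (by simp) ?_)
    · simp [hpq.ne]
    · intro a ha
      simp at ha
      rw [ha]; exact hne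
  obtain ⟨h, y, hy0, hyv, hinj, hadj, hym⟩ := hear q ⟨p, hp, hpq⟩
  have hex : ∃ j, y j ∈ c.support := ⟨_, hyv⟩
  set j := Nat.find hex with hj
  have hjc : y j ∈ c.support := Nat.find_spec hex
  have hjmin : ∀ i < j, y i ∉ c.support := fun i hi => Nat.find_min hex hi
  have hjle : j ≤ 2 * h := Nat.find_min' hex hyv
  have hj0 : j ≠ 0 := fun h0 => hq (by rw [h0, hy0] at hjc; exact hjc)
  have hjev : j % 2 = 0 := by
    by_contra hodd
    have h1 := hym (j - 1) (by omega) (by omega)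
    rw [Nat.sub_add_cancel (by omega)] at h1
    have h2 := hmc _ hjc
    rw [h1, hm.1] at h2
    exact hjmin (j - 1) (by omega) h2
  have hadj' : ∀ i, i < j → G.Adj (y i) (y (i+1)) := fun i hi => hFG (hadj i (by omega))
  by_cases hz : y j = p
  · refine cyc_deg hG c hc hp (hFG hpq) (r := y (j - 1)) ?_ ?_ hq (hjmin _ (by omega))
    · have := hadj' (j - 1) (by omega)
      rw [Nat.sub_add_cancel (by omega), hz] at this
      exact this.symm
    · rw [← hy0]
      intro h3
      have := hinj _ (by omega) _ (by omega) h3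
      omega
  · let f : ℕ → V := fun i => if i = 0 then p else y (i - 1)
    have hf0 : f 0 = p := rfl
    have hfs : ∀ i, f (i + 1) = y i := fun i => rfl
    have hfadj : ∀ i < j + 1, G.Adj (f i) (f (i + 1)) := by
      intro i hi
      cases i with
      | zero => rw [hfs, hf0, hy0]; exact hFG hpq
      | succ i => rw [hfs, hfs]; exact hadj' i (by omega)
    have hpy : ∀ i ≤ j, p ≠ y i := by
      intro i hi h3
      by_cases hij : i = j
      · rw [hij] at h3; exact hz h3.symm
      · exact hjmin i (by omega) (h3 ▸ hp)
    obtain ⟨e, he1, he2, he3⟩ := seq_path (H := G) f (j + 1) hfadj (by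
      intro a ha b hb hab
      cases a with
      | zero =>
        cases b with
        | zero => rfl
        | succ b => exact absurd hab (hpy b (by omega))
      | succ a =>
        cases b with
        | zero => exact absurd hab.symm (hpy a (by omega))
        | succ b => rw [hinj a (by omega) b (by omega) hab])
    refine hT (theta_of_ear c hc ho (p := f 0) (z := f (j + 1)) hp hjc (Ne.symm hz) e he1 ?_ ?_)
    · rw [he2, Nat.odd_iff]; omega
    · intro a ha hac
      induction a using Sym2.ind with
      | h a b =>
        obtain ⟨i, hi, hab⟩ := (Walk.mk_mem_edges_iff_exists e).1 ha
        rw [he3 i (by omega), he3 (i+1) (by omega)] at hab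
        rw [← hab] at hac
        cases i with
        | zero =>
          have := c.snd_mem_support_of_mem_edges hac
          rw [hfs, hy0] at this
          exact hq this
        | succ i =>
          have := c.fst_mem_support_of_mem_edges hac
          rw [hfs] at this
          exact hjmin i (by omega) this

theorem core_cycle (hG : Subcubic G) (hT : ¬ HasSkewedTheta G) (hFG : F ≤ G)
    (hd : ∀ v, ω s(v, v) = 0) (hF : ∀ u v, F.Adj u v → 0 < ω s(u, v))
    {u v : V} (huv : F.Adj u v)
    (hK : ∀ x, F.Reachable u x → ∃ m, IsMaxMat F ω m ∧ m x = x) :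
    ∃ (x : V) (c : G.Walk x x), c.IsCycle ∧ Odd c.length ∧
      (∀ m, IsMaxMat F ω m → ∀ a ∈ c.support, ∀ b ∈ c.support, m a = a → m b = b → a = b) ∧
      (∀ m, IsMaxMat F ω m → ∀ a ∈ c.support, m a ≠ a → s(a, m a) ∈ c.edges) := by
  have hsim : ∀ a b, F.Reachable u a → F.Reachable u b → Sim F ω a b := by
    intro a b ha hb
    obtain ⟨p⟩ := ha.symm.trans hb
    exact sim_of_reachable hd hF p fun x hx => hK x (ha.trans hx)
  have huniq : ∀ m, IsMaxMat F ω m → ∀ a b, F.Reachable u a → F.Reachable u b →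
      m a = a → m b = b → a = b := by
    intro m hm a b ha hb h1 h2
    rcases hsim a b ha hb with h | h
    · exact h
    · exact absurd ⟨h1, h2⟩ (h m hm)
  have hru : F.Reachable u u := Reachable.refl u
  have hrv : F.Reachable u v := huv.reachable
  obtain ⟨n, hn, hnu⟩ := hK u hru
  obtain ⟨m, hm, hmv⟩ := hK v hrv
  obtain ⟨h, y, hy0, hyv, hinj, hadj, hym, hmi, -⟩ := alt_path hm.1 hn.1 (u := u) (v := v) hnu
    (fun x hx h1 => huniq n hn x u hx hru h1 hnu) (fun x hx h1 => huniq m hm x v hx hrv h1 hmv)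
  have hh : h ≠ 0 := by
    rintro rfl
    exact huv.ne (hy0.symm.trans hyv)
  obtain ⟨c, hc, hcl, hcs⟩ := seq_cycle (H := G) y (2 * h) (by omega) (fun i hi => hFG (hadj i hi))
    hinj (by rw [hy0, hyv]; exact (hFG huv).symm)
  have hyr : ∀ i ≤ 2 * h, F.Reachable u (y i) := by
    intro i
    induction i with
    | zero => intro _; rw [hy0]
    | succ i ih => intro hi; exact (ih (by omega)).trans (hadj i (by omega)).reachable
  have hcr : ∀ a ∈ c.support, F.Reachable u a := by
    intro a ha
    obtain ⟨i, hi, rfl⟩ := (hcs a).1 ha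
    exact hyr i hi
  have hvc : v ∈ c.support := (hcs v).2 ⟨2 * h, le_rfl, hyv⟩
  have hco : Odd c.length := ⟨h, hcl⟩
  refine ⟨_, c, hc, hco, ?_, ?_⟩
  · intro m' hm' a ha b hb h1 h2
    exact huniq m' hm' a b (hcr a ha) (hcr b hb) h1 h2
  · intro m' hm' a ha hne
    refine ear_closed hG hT hFG c hc hco hm.1 ?_ ?_ ha (hm'.1.2 a hne)
    · intro b hb
      obtain ⟨i, hi, rfl⟩ := (hcs b).1 hb
      obtain ⟨j, hj, hij⟩ := hmi i hi
      exact (hcs _).2 ⟨j, hj, hij.symm⟩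
    · rintro q ⟨p, hp, hpq⟩
      have hrq : F.Reachable u q := (hcr p hp).trans hpq.reachable
      obtain ⟨n', hn', hq⟩ := hK q hrq
      obtain ⟨h', y', g0, gv, ginj, gadj, gm, -⟩ := alt_path hm.1 hn'.1 (u := q) (v := v) hq
        (fun x hx h1 => huniq n' hn' x q (hrq.trans hx) hrq h1 hq)
        (fun x hx h1 => huniq m hm x v (hrq.trans hx) hrv h1 hmv)
      exact ⟨h', y', g0, gv ▸ hvc, ginj, gadj, gm⟩

end Core


section Faces

set_option linter.unusedSectionVars false

theorem tstab_cycle {W : Type*} [Fintype W] {H : SimpleGraph W} {y : W → ℝ} (hy : y ∈ TSTAB H)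
    {v : W} (c : H.Walk v v) (hc : c.IsCycle) (ho : Odd c.length) (D : Finset W)
    (hD : ∀ u, u ∈ D ↔ u ∈ c.support) : ∑ u ∈ D, y u ≤ ((c.length / 2 : ℕ) : ℝ) := by
  refine le_trans (le_of_eq ?_) (hy.2.2 v c hc ho)
  apply Finset.sum_congr _ (fun _ _ => rfl)
  ext u; simp [hD]

variable {V : Type u} [Fintype V] {G : SimpleGraph V}

/-- the edges of the matching `m` -/
def matEdges (G : SimpleGraph V) (m : V → V) : Set G.edgeSet :=
  {e | ∃ u, m u ≠ u ∧ (e : Sym2 V) = s(u, m u)}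

theorem mem_matEdges_of_mem {m : V → V} (hinv : ∀ v, m (m v) = v) {e : G.edgeSet}
    (he : e ∈ matEdges G m) {v : V} (hv : v ∈ (e : Sym2 V)) :
    m v ≠ v ∧ (e : Sym2 V) = s(v, m v) := by
  obtain ⟨u, hu, heu⟩ := he
  rw [heu] at hv
  rcases Sym2.mem_iff.1 hv with rfl | rfl
  · exact ⟨hu, heu⟩
  · rw [hinv]; exact ⟨hu.symm, heu.trans Sym2.eq_swap⟩

theorem matEdges_stable {m : V → V} (hinv : ∀ v, m (m v) = v) :
    StableSet G.lineGraph (matEdges G m) := by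
  intro e he f hf hef hadj
  obtain ⟨-, v, h1, h2⟩ := lineGraph_adj_iff_exists.1 hadj
  apply hef
  apply Subtype.ext
  rw [(mem_matEdges_of_mem hinv he h1).2, (mem_matEdges_of_mem hinv hf h2).2]

theorem mat_sum {m : V → V} (hinv : ∀ v, m (m v) = v) (hadj : ∀ v, m v ≠ v → G.Adj v (m v))
    (g : Sym2 V → ℝ) (hg : ∀ v, g s(v, v) = 0) :
    ∑ v, g s(v, m v) =
      2 * ((fun e : G.edgeSet => g e) ⬝ᵥ ((matEdges G m).indicator 1 : G.edgeSet → ℝ)) := by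
  have h1 : ∀ v, g s(v, m v) = ∑ e : G.edgeSet, if v ∈ (e : Sym2 V) then
      g e * ((matEdges G m).indicator 1 : G.edgeSet → ℝ) e else 0 := by
    intro v
    by_cases hv : m v = v
    · rw [hv, hg, eq_comm]
      apply Finset.sum_eq_zero
      intro e _
      split_ifs with h
      · rw [Set.indicator_of_notMem, mul_zero]
        intro he
        exact (mem_matEdges_of_mem hinv he h).1 hv
      · rfl
    · rw [Finset.sum_eq_single (⟨s(v, m v), hadj v hv⟩ : G.edgeSet)]
      · rw [if_pos (by simp), Set.indicator_of_mem]
        · simp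
        · exact ⟨v, hv, rfl⟩
      · intro e _ hne
        split_ifs with h
        · rw [Set.indicator_of_notMem, mul_zero]
          intro he
          exact hne (Subtype.ext (mem_matEdges_of_mem hinv he h).2)
        · rfl
      · simp
  rw [Finset.sum_congr rfl (fun v _ => h1 v), Finset.sum_comm, dotProduct, Finset.mul_sum]
  apply Finset.sum_congr rfl
  intro e _
  rw [← Finset.sum_filter, Finset.sum_const, nsmul_eq_mul]
  have : (Finset.univ.filter (fun v => v ∈ (e : Sym2 V))) = (e : Sym2 V).toFinset := by
    ext v; simp
  rw [this, Sym2.card_toFinset_of_not_isDiag _ (G.not_isDiag_of_mem_edgeSet e.2)]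
  norm_num

theorem exists_mat {s : Set G.edgeSet} (hs : StableSet G.lineGraph s) :
    ∃ m : V → V, (∀ v, m (m v) = v) ∧ (∀ v, m v ≠ v → G.Adj v (m v)) ∧ matEdges G m = s := by
  let m : V → V := fun v => if h : ∃ u, ∃ e ∈ s, (e : Sym2 V) = s(v, u) then h.choose else v
  have hA : ∀ v u, (∃ e ∈ s, (e : Sym2 V) = s(v, u)) → m v = u := by
    intro v u hu
    have h : ∃ u, ∃ e ∈ s, (e : Sym2 V) = s(v, u) := ⟨u, hu⟩
    have h1 := h.choose_spec
    simp only [m, dif_pos h]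
    obtain ⟨e, he, hev⟩ := hu
    obtain ⟨f, hf, hfv⟩ := h1
    have hef : e = f := by
      by_contra hne
      exact hs he hf hne (lineGraph_adj_iff_exists.2 ⟨hne, v, by rw [hev]; simp, by rw [hfv]; simp⟩)
    rw [hef] at hev
    exact Sym2.congr_right.1 (hfv.symm.trans hev)
  have hB : ∀ v, m v ≠ v → ∃ e ∈ s, (e : Sym2 V) = s(v, m v) := by
    intro v hv
    by_cases h : ∃ u, ∃ e ∈ s, (e : Sym2 V) = s(v, u)
    · have h1 := h.choose_spec
      simp only [m, dif_pos h]
      exact h1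
    · exact absurd (by simp only [m, dif_neg h]) hv
  refine ⟨m, ?_, ?_, ?_⟩
  · intro v
    by_cases hv : m v = v
    · rw [hv, hv]
    · obtain ⟨e, he, hev⟩ := hB v hv
      exact hA _ _ ⟨e, he, hev.trans Sym2.eq_swap⟩
  · intro v hv
    obtain ⟨e, he, hev⟩ := hB v hv
    have := e.2
    rw [hev] at this
    exact this
  · ext e
    constructor
    · rintro ⟨u, hu, heu⟩
      obtain ⟨f, hf, hfu⟩ := hB u hu
      rwa [show e = f from Subtype.ext (heu.trans hfu.symm)]
    · intro he
      obtain ⟨e, h⟩ := e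
      induction e using Sym2.ind with
      | h a b =>
        have h1 := hA a b ⟨_, he, rfl⟩
        have h2 : G.Adj a b := h
        exact ⟨a, by rw [h1]; exact h2.ne.symm, by rw [h1]⟩

/-- zero extension of the weights -/
noncomputable def extW (w : G.edgeSet → ℝ) (e : Sym2 V) : ℝ :=
  if h : e ∈ G.edgeSet then w ⟨e, h⟩ else 0

theorem extW_coe (w : G.edgeSet → ℝ) (e : G.edgeSet) : extW w e = w e := by
  simp [extW]

theorem extW_diag (w : G.edgeSet → ℝ) (v : V) : extW w s(v, v) = 0 := by
  simp [extW]

/-- graph of positive edges -/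
def posG (w : G.edgeSet → ℝ) : SimpleGraph V where
  Adj u v := 0 < extW w s(u, v)
  symm := ⟨fun u v h => by rwa [Sym2.eq_swap]⟩
  loopless := ⟨fun v h => by rw [extW_diag] at h; exact lt_irrefl _ h⟩

theorem posG_le (w : G.edgeSet → ℝ) : posG w ≤ G := by
  intro u v h
  by_contra hn
  have h : 0 < extW w s(u, v) := h
  have hn : s(u, v) ∉ G.edgeSet := hn
  simp only [extW, dif_neg hn, lt_irrefl] at h

theorem isMax_of_stable (w : G.edgeSet → ℝ) (hw : ∀ e, 0 ≤ w e) {s : Set G.edgeSet}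
    (hs : StableSet G.lineGraph s)
    (hmax : ∀ t, StableSet G.lineGraph t →
      w ⬝ᵥ (t.indicator 1 : G.edgeSet → ℝ) ≤ w ⬝ᵥ (s.indicator 1 : G.edgeSet → ℝ)) :
    ∃ m, IsMaxMat (posG w) (extW w) m ∧ matEdges G m ⊆ s := by
  let s' : Set G.edgeSet := {e | e ∈ s ∧ 0 < w e}
  have hs' : StableSet G.lineGraph s' := fun e he f hf => hs he.1 hf.1
  obtain ⟨m, hinv, hadj, hms⟩ := exists_mat hs'
  have hwe : (fun e : G.edgeSet => extW w e) = w := funext fun e => extW_coe w e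
  refine ⟨m, ⟨⟨hinv, ?_⟩, ?_⟩, hms ▸ fun e he => he.1⟩
  · intro v hv
    have h1 : (⟨s(v, m v), hadj v hv⟩ : G.edgeSet) ∈ s' := hms ▸ ⟨v, hv, rfl⟩
    have h2 := h1.2
    rw [← extW_coe w] at h2
    exact h2
  · intro n hn
    have h1 := mat_sum (G := G) hinv hadj (extW w) (extW_diag w)
    have h2 := mat_sum (G := G) hn.1 (fun v hv => posG_le w (hn.2 v hv)) (extW w) (extW_diag w)
    rw [hwe] at h1 h2
    unfold matW
    rw [h1, h2, hms]
    have h3 : w ⬝ᵥ (s'.indicator 1 : G.edgeSet → ℝ) = w ⬝ᵥ (s.indicator 1 : G.edgeSet → ℝ) := by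
      apply Finset.sum_congr rfl
      intro e _
      by_cases h4 : e ∈ s
      · by_cases h5 : 0 < w e
        · have h6 : e ∈ s' := ⟨h4, h5⟩
          rw [Set.indicator_of_mem h4, Set.indicator_of_mem h6]
        · rw [le_antisymm (not_lt.1 h5) (hw e)]; simp
      · rw [Set.indicator_of_notMem h4, Set.indicator_of_notMem (fun h : e ∈ s' => h4 h.1)]
    rw [h3]
    linarith [hmax _ (matEdges_stable (G := G) hn.1)]

theorem star_valid (hG : Subcubic G) (v : V) {y : G.edgeSet → ℝ} (hy : y ∈ TSTAB G.lineGraph) :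
    (fun e : G.edgeSet => if v ∈ (e : Sym2 V) then (1 : ℝ) else 0) ⬝ᵥ y ≤ 1 := by
  simp only [dotProduct, ite_mul, one_mul, zero_mul]
  rw [← Finset.sum_filter]
  set D := Finset.univ.filter (fun e : G.edgeSet => v ∈ (e : Sym2 V)) with hD
  have hDm : ∀ e, e ∈ D ↔ v ∈ (e : Sym2 V) := by intro e; simp [hD]
  have hadj : ∀ e ∈ D, ∀ f ∈ D, e ≠ f → G.lineGraph.Adj e f := fun e he f hf hef =>
    lineGraph_adj_iff_exists.2 ⟨hef, v, (hDm e).1 he, (hDm f).1 hf⟩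
  have hcard : D.card ≤ 3 := by
    have hex : ∀ e : G.edgeSet, ∃ u, e ∈ D → (e : Sym2 V) = s(v, u) := by
      intro e
      by_cases he : e ∈ D
      · obtain ⟨u, hu⟩ := (hDm e).1 he
        exact ⟨u, fun _ => hu⟩
      · exact ⟨v, fun h => absurd h he⟩
    choose f hf using hex
    have h1 := Set.ncard_le_ncard_of_injOn (s := (D : Set G.edgeSet)) (t := G.neighborSet v) f
      (by
        intro e he
        have := e.2
        rw [hf e he] at this
        exact this)
      (by
        intro e he e' he' hee
        apply Subtype.ext
        rw [hf e he, hf e' he', hee]) (Set.toFinite _)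
    rw [Set.ncard_coe_finset] at h1
    exact h1.trans (hG v)
  interval_cases hc : D.card
  · rw [Finset.card_eq_zero.1 hc]; simp
  · obtain ⟨e, he⟩ := Finset.card_eq_one.1 hc
    rw [he, Finset.sum_singleton]; exact (hy.1 e).2
  · obtain ⟨e, f, hef, he⟩ := Finset.card_eq_two.1 hc
    rw [he, Finset.sum_pair hef]
    exact hy.2.1 e f (hadj e (by simp [he]) f (by simp [he]) hef)
  · obtain ⟨e, f, g, hef, heg, hfg, he⟩ := Finset.card_eq_three.1 hc
    have h1 := hadj e (by simp [he]) f (by simp [he]) hef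
    have h2 := hadj f (by simp [he]) g (by simp [he]) hfg
    have h3 := hadj g (by simp [he]) e (by simp [he]) heg.symm
    let c : G.lineGraph.Walk e e := Walk.cons h1 (Walk.cons h2 (Walk.cons h3 Walk.nil))
    have hcyc : c.IsCycle := by
      simp [c, Walk.cons_isCycle_iff, hef, heg, hfg, hef.symm, heg.symm, hfg.symm]
    have := tstab_cycle hy c hcyc ⟨1, rfl⟩ D (by intro u; rw [he]; simp [c]; tauto)
    exact this.trans (by norm_num [c])

end Faces


section Final

variable {V : Type u} [Fintype V] {G : SimpleGraph V}

theorem key_face (hG : Subcubic G) (hT : ¬ HasSkewedTheta G) (w : G.edgeSet → ℝ) (hw : w ≠ 0) :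
    ∃ (a : G.edgeSet → ℝ) (β : ℝ), (∀ y ∈ TSTAB G.lineGraph, a ⬝ᵥ y ≤ β) ∧
      (∀ s, StableSet G.lineGraph s → (∀ t, StableSet G.lineGraph t →
        w ⬝ᵥ (t.indicator 1 : G.edgeSet → ℝ) ≤ w ⬝ᵥ (s.indicator 1 : G.edgeSet → ℝ)) →
        a ⬝ᵥ (s.indicator 1 : G.edgeSet → ℝ) = β) ∧
      ∃ s, StableSet G.lineGraph s ∧ a ⬝ᵥ (s.indicator 1 : G.edgeSet → ℝ) < β := by
  have hmemT : ∀ s, StableSet G.lineGraph s →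
      (s.indicator 1 : G.edgeSet → ℝ) ∈ TSTAB G.lineGraph := fun s hs =>
    stab_subset_tstab (subset_convexHull ℝ _ ⟨s, hs, rfl⟩)
  have hempty : StableSet G.lineGraph (∅ : Set G.edgeSet) := Set.pairwise_empty _
  have hind0 : ∀ (s : Set G.edgeSet) e, 0 ≤ (s.indicator 1 : G.edgeSet → ℝ) e := by
    intro s e
    exact Set.indicator_nonneg (fun _ _ => zero_le_one) e
  by_cases hneg : ∃ e, w e < 0
  · obtain ⟨e, he⟩ := hneg
    have hdot : ∀ y : G.edgeSet → ℝ, (Pi.single e (-1 : ℝ)) ⬝ᵥ y = - y e := by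
      intro y; rw [single_dotProduct]; ring
    refine ⟨Pi.single e (-1), 0, ?_, ?_, {e}, Set.pairwise_singleton _ _, ?_⟩
    · intro y hy
      rw [hdot]; linarith [(hy.1 e).1]
    · intro s hs hmax
      rw [hdot]
      by_cases hes : e ∈ s
      · exfalso
        have h1 := hmax (s \ {e}) (hs.mono Set.diff_subset)
        have h2 : (s.indicator 1 : G.edgeSet → ℝ) =
            (s \ {e}).indicator 1 + Pi.single e (1 : ℝ) := by
          ext f
          by_cases hf : f = e
          · subst hf; simp [hes]
          · simp [Set.indicator_apply, hf]
        rw [h2, dotProduct_add, dotProduct_single] at h1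
        linarith
      · simp [hes]
    · rw [hdot]; simp
  push Not at hneg
  have hpos : ∃ e, 0 < w e := by
    by_contra hcon
    push Not at hcon
    exact hw (funext fun e => le_antisymm (hcon e) (hneg e))
  obtain ⟨e0, he0⟩ := hpos
  obtain ⟨u, v, huv⟩ : ∃ u v, (posG w).Adj u v := by
    rw [← extW_coe w] at he0
    obtain ⟨e, h⟩ := e0
    induction e using Sym2.ind with
    | h a b => exact ⟨a, b, he0⟩
  by_cases hK : ∀ x, (posG w).Reachable u x → ∃ m, IsMaxMat (posG w) (extW w) m ∧ m x = x
  · obtain ⟨x, c, hc, ho, hone, hclosed⟩ := core_cycle hG hT (posG_le w) (extW_diag w)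
      (fun _ _ h => h) huv hK
    let g : Sym2 V → ℝ := fun e => if e ∈ c.edges then 1 else 0
    have hvalid : ∀ y ∈ TSTAB G.lineGraph, (fun e : G.edgeSet => g e) ⬝ᵥ y ≤
        ((c.length / 2 : ℕ) : ℝ) := by
      intro y hy
      obtain ⟨e, d, hd, hdl, hds⟩ := lg_cycle c hc
      simp only [dotProduct, g, ite_mul, one_mul, zero_mul]
      rw [← Finset.sum_filter, ← hdl]
      exact tstab_cycle hy d hd (hdl ▸ ho) _ (by intro f; simp [hds])
    refine ⟨fun e => g e, ((c.length / 2 : ℕ) : ℝ), hvalid, ?_, ∅, hempty, ?_⟩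
    · intro s hs hmax
      apply le_antisymm (hvalid _ (hmemT s hs))
      obtain ⟨m, hm, hms⟩ := isMax_of_stable w hneg hs hmax
      have hsum := mat_sum (G := G) hm.1.1 (fun v hv => posG_le w (hm.1.2 v hv)) g (by
        intro v
        simp only [g]
        rw [if_neg]
        intro h
        exact (G.loopless.irrefl v) (c.adj_of_mem_edges h))
      have h1 : (fun e : G.edgeSet => g e) ⬝ᵥ ((matEdges G m).indicator 1 : G.edgeSet → ℝ) ≤
          (fun e : G.edgeSet => g e) ⬝ᵥ (s.indicator 1 : G.edgeSet → ℝ) := by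
        apply Finset.sum_le_sum
        intro e _
        apply mul_le_mul_of_nonneg_left
        · exact Set.indicator_le_indicator_of_subset hms (fun _ => zero_le_one) e
        · simp only [g]; split_ifs <;> norm_num
      have h2 : ((c.length - 1 : ℕ) : ℝ) ≤ ∑ v, g s(v, m v) := by
        have hcc : c.support.toFinset.card = c.length := by
          rw [cyc_support_toFinset c hc, Finset.card_image_of_injOn (cyc_injOn c hc),
            Finset.card_range]
        have hfix : (c.support.toFinset.filter (fun v => m v = v)).card ≤ 1 := by
          rw [Finset.card_le_one]
          intro a ha b hb
          simp only [Finset.mem_filter, List.mem_toFinset] at ha hb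
          exact hone m hm a ha.1 b hb.1 ha.2 hb.2
        have hsplit := Finset.card_filter_add_card_filter_not (s := c.support.toFinset)
          (fun v => m v = v)
        have h3 : ((c.support.toFinset.filter (fun v => ¬ m v = v)).card : ℝ) ≤
            ∑ v, g s(v, m v) := by
          rw [Finset.card_eq_sum_ones, Nat.cast_sum]
          refine le_trans ?_ (Finset.sum_le_sum_of_subset_of_nonneg
            (Finset.subset_univ (c.support.toFinset.filter (fun v => ¬ m v = v))) ?_)
          · apply Finset.sum_le_sum
            intro a ha
            simp only [Finset.mem_filter, List.mem_toFinset] at ha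
            simp only [g]
            rw [if_pos (hclosed m hm a ha.1 ha.2)]
            simp
          · intro a _ _
            simp only [g]; split_ifs <;> norm_num
        refine le_trans ?_ h3
        exact_mod_cast (by omega)
      have h4 : (2 * (c.length / 2) : ℕ) = c.length - 1 := by
        obtain ⟨k, hk⟩ := ho; omega
      have h5 : (2 : ℝ) * ((c.length / 2 : ℕ) : ℝ) = ((c.length - 1 : ℕ) : ℝ) := by
        exact_mod_cast h4
      linarith
    · have := hc.three_le_length
      have h6 : 0 < c.length / 2 := by omega
      simpa using h6
  · push Not at hK
    obtain ⟨x, -, hx⟩ := hK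
    refine ⟨fun e => if x ∈ (e : Sym2 V) then 1 else 0, 1, fun y hy => star_valid hG x hy, ?_,
      ∅, hempty, by simp⟩
    intro s hs hmax
    apply le_antisymm (star_valid hG x (hmemT s hs))
    obtain ⟨m, hm, hms⟩ := isMax_of_stable w hneg hs hmax
    have hmx := hx m hm
    let e : G.edgeSet := ⟨s(x, m x), posG_le w (hm.1.2 x hmx)⟩
    have hes : e ∈ s := hms ⟨x, hmx, rfl⟩
    refine le_trans (le_of_eq ?_) (Finset.single_le_sum (fun f _ => mul_nonneg ?_ (hind0 s f))
      (Finset.mem_univ e))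
    · rw [Set.indicator_of_mem hes]; simp [e]
    · split_ifs <;> norm_num

theorem tperfect_of (hG : Subcubic G) (hT : ¬ HasSkewedTheta G) : TPerfect G.lineGraph := by
  apply Set.Subset.antisymm stab_subset_tstab
  have hfin : {x : G.edgeSet → ℝ | ∃ s : Set G.edgeSet, StableSet G.lineGraph s ∧
      x = s.indicator 1}.Finite := by
    apply (Set.finite_range (fun s : Set G.edgeSet => (s.indicator 1 : G.edgeSet → ℝ))).subset
    rintro x ⟨s, -, rfl⟩
    exact ⟨s, rfl⟩
  have hmem : ∀ s, StableSet G.lineGraph s →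
      (s.indicator 1 : G.edgeSet → ℝ) ∈ hfin.toFinset := fun s hs =>
    hfin.mem_toFinset.2 ⟨s, hs, rfl⟩
  have h := poly_sub hfin.toFinset ⟨_, hmem ∅ (Set.pairwise_empty _)⟩ (TSTAB G.lineGraph) ?_
  · rw [hfin.coe_toFinset] at h
    exact h
  · intro w hw
    obtain ⟨a, β, h1, h2, s, hs, hs'⟩ := key_face hG hT w hw
    refine ⟨a, β, h1, ?_, ?_, _, hmem s hs, hs'⟩
    · intro x hx
      apply h1
      apply stab_subset_tstab
      exact subset_convexHull ℝ _ (hfin.mem_toFinset.1 hx)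
    · intro x hx hmax
      obtain ⟨t, ht, rfl⟩ := hfin.mem_toFinset.1 hx
      exact h2 t ht (fun t' ht' => hmax _ (hmem t' ht'))

end Final

/-- the line graph of a graph `G` is t-perfect if and only if `G` is
subcubic and contains no skewed theta. -/
theorem stmt_19 {V : Type u} [Fintype V] (G : SimpleGraph V) :
    TPerfect G.lineGraph ↔ (Subcubic G ∧ ¬ HasSkewedTheta G) := by
  constructor
  · intro h
    exact ⟨subcubic_of_tperfect h, no_theta_of_tperfect (subcubic_of_tperfect h) h⟩
  · rintro ⟨hG, hT⟩
    exact tperfect_of hG hT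
end
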